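/- arXiv:1603.06801 — 8 statements merged into one kernel-verified Lean document; each statement's English description precedes it below -/
import Mathlib

section
/- Let f, g : [0,1] → ℝ be concave, nondecreasing functions with f(0) = g(0), f(1) = g(1), and f(x) ≤ g(x) for all x ∈ [0,1]. Then the Minkowski length of the graph of g is at most the Minkowski length of the graph of f, i.e., ∫₀¹ √(g′(x)) dx ≤ ∫₀¹ √(f′(x)) dx. (Of two nested convex ROC curves with common endpoints, the outer one is shorter in the Minkowski metric.) -/
open Set MeasureTheory in
lemma mink_right_deriv (f : ℝ → ℝ) (hf : ConcaveOn ℝ (Icc 0 1) f) (hfm : MonotoneOn f (Icc 0 1)) :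
    ∃ p : ℝ → ℝ, Measurable p ∧ AntitoneOn p (Ioo 0 1) ∧ (∀ x ∈ Ioo (0:ℝ) 1, 0 ≤ p x) ∧
      IntegrableOn p (Ioc 0 1) ∧ (∀ a ∈ Ioo (0:ℝ) 1, ∫ x in a..1, p x = f 1 - f a) ∧
      ∀ᵐ x, x ∈ Ioo (0:ℝ) 1 → derivWithin f (Icc 0 1) x = p x := by
  set F : ℝ → ℝ := fun x => f (min x 1) with hF
  have himg : (fun x : ℝ => min x 1) '' (Ici 0) = Icc 0 1 := by
    ext y
    simp only [mem_image, mem_Ici, mem_Icc]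
    constructor
    · rintro ⟨x, hx, rfl⟩
      exact ⟨le_min hx zero_le_one, min_le_right _ _⟩
    · rintro ⟨h0, h1⟩
      exact ⟨y, h0, min_eq_left h1⟩
  have hFc : ConcaveOn ℝ (Ici 0) F := by
    have h1 : ConcaveOn ℝ (Ici (0:ℝ)) (fun x : ℝ => min x 1) :=
      (concaveOn_id (convex_Ici 0)).inf (concaveOn_const 1 (convex_Ici 0))
    exact ConcaveOn.comp (by rw [himg]; exact hf) h1 (by rw [himg]; exact hfm)
  have hint : interior (Ici (0:ℝ)) = Ioi 0 := interior_Ici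
  have hcont : ContinuousOn F (Ioi 0) := hint ▸ hFc.continuousOn_interior
  set p : ℝ → ℝ := fun x => derivWithin F (Ioi x) x with hp
  have hdiff : ∀ x ∈ Ioi (0:ℝ), DifferentiableWithinAt ℝ F (Ioi x) x := by
    intro x hx
    have := hFc.neg.differentiableWithinAt_Ioi_of_mem_interior (x := x) (by rw [hint]; exact hx)
    simpa using this.neg
  have hanti : AntitoneOn p (Ioi 0) := by
    have := hFc.neg.monotoneOn_rightDeriv
    rw [hint] at this
    intro x hx y hy hxy
    have h := this hx hy hxy
    simp only [derivWithin.neg] at h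
    simp only [hp]
    linarith
  have hnn : ∀ x ∈ Ioo (0:ℝ) 1, 0 ≤ p x := by
    intro x hx
    have h := hFc.slope_le_rightDeriv (x := x) (y := 1) hx.1.le (mem_Ici.2 zero_le_one) hx.2
      (hdiff x hx.1)
    refine le_trans ?_ h
    rw [slope_def_field]
    refine div_nonneg ?_ (by linarith [hx.2])
    simp only [hF, min_self, min_eq_left hx.2.le]
    linarith [hfm ⟨hx.1.le, hx.2.le⟩ (right_mem_Icc.2 zero_le_one) hx.2.le]
  have hFf : ∀ x ∈ Ioo (0:ℝ) 1, F =ᶠ[nhds x] f := by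
    intro x hx
    filter_upwards [Iio_mem_nhds hx.2] with y hy
    simp only [hF, min_eq_left (le_of_lt (mem_Iio.1 hy))]
  have hae : ∀ᵐ x, x ∈ Ioo (0:ℝ) 1 → DifferentiableAt ℝ f x := by
    filter_upwards [hfm.ae_differentiableWithinAt_of_mem] with x hx hx1
    exact (hx ⟨hx1.1.le, hx1.2.le⟩).differentiableAt (Icc_mem_nhds hx1.1 hx1.2)
  have hpd : ∀ x ∈ Ioo (0:ℝ) 1, DifferentiableAt ℝ f x → p x = deriv f x := by
    intro x hx hd
    have h1 := hd.hasDerivAt.congr_of_eventuallyEq (hFf x hx)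
    exact h1.hasDerivWithinAt.derivWithin (uniqueDiffWithinAt_Ioi x)
  have hI : IntegrableOn p (Ioc 0 1) := by
    have h1 : IntervalIntegrable (deriv f) volume 0 1 :=
      MonotoneOn.intervalIntegrable_deriv (by rw [uIcc_of_le zero_le_one]; exact hfm)
    rw [intervalIntegrable_iff_integrableOn_Ioo_of_le zero_le_one] at h1
    rw [integrableOn_Ioc_iff_integrableOn_Ioo]
    refine h1.congr_fun_ae ?_
    rw [Filter.EventuallyEq, ae_restrict_iff' measurableSet_Ioo]
    filter_upwards [hae] with x hx hx1
    exact (hpd x hx1 (hx hx1)).symm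
  refine ⟨p, measurable_derivWithin_Ioi F, hanti.mono Ioo_subset_Ioi_self, hnn, hI, ?_, ?_⟩
  · intro a ha
    have := intervalIntegral.integral_eq_sub_of_hasDeriv_right_of_le (f := F) (f' := p) ha.2.le
      (hcont.mono fun x hx => lt_of_lt_of_le ha.1 hx.1)
      (fun x hx => (hdiff x (lt_trans ha.1 hx.1)).hasDerivWithinAt)
      ((intervalIntegrable_iff_integrableOn_Ioc_of_le ha.2.le).2
        (hI.mono_set (Ioc_subset_Ioc_left ha.1.le)))
    rw [this]
    simp only [hF, min_self, min_eq_left ha.2.le]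
  · filter_upwards [hae] with x hx hx1
    rw [hpd x hx1 (hx hx1), derivWithin_of_mem_nhds (Icc_mem_nhds hx1.1 hx1.2)]

open Set MeasureTheory in
lemma mink_bonnet (r φ : ℝ → ℝ) (M : ℝ) (hr : IntegrableOn r (Ioc 0 1)) (hφ : Measurable φ)
    (hm : MonotoneOn φ (Ioo 0 1)) (h0 : ∀ x ∈ Ioo (0:ℝ) 1, 0 ≤ φ x)
    (hM : ∀ x ∈ Ioo (0:ℝ) 1, φ x ≤ M)
    (ha : ∀ a ∈ Ioo (0:ℝ) 1, ∫ x in a..1, r x ≤ 0) :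
    ∫ x in Ioo 0 1, r x * φ x ≤ 0 := by
  have ha0 : ∀ a ∈ Ico (0:ℝ) 1, ∫ x in a..1, r x ≤ 0 := by
    have hc : ContinuousOn (fun a => ∫ x in a..1, r x) (uIcc 0 1) := by
      apply intervalIntegral.continuousOn_primitive_interval_left
      rw [uIcc_of_le zero_le_one, integrableOn_Icc_iff_integrableOn_Ioc]
      exact hr
    rw [uIcc_of_le zero_le_one] at hc
    intro a haa
    have hcl : a ∈ closure (Ioo (0:ℝ) 1) := by
      rw [closure_Ioo (by norm_num)]; exact ⟨haa.1, haa.2.le⟩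
    exact ContinuousWithinAt.closure_le hcl
      ((hc a ⟨haa.1, haa.2.le⟩).mono Ioo_subset_Icc_self) continuousWithinAt_const ha
  have hr' : IntegrableOn r (Ioo 0 1) := hr.mono_set Ioo_subset_Ioc_self
  have hU : ∀ l : ℝ, ∫ x in Ioo 0 1, (if l < φ x then r x else 0) ≤ 0 := by
    intro l
    have hms : MeasurableSet {x | l < φ x} := measurableSet_lt measurable_const hφ
    have e1 : (fun x => if l < φ x then r x else 0) = indicator {x | l < φ x} r := by
      ext x; simp [indicator]
    rw [e1, setIntegral_indicator hms]
    set U := Ioo (0:ℝ) 1 ∩ {x | l < φ x} with hUd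
    rcases U.eq_empty_or_nonempty with h | ⟨y, hy⟩
    · rw [h]; simp
    have hbdd : BddBelow U := ⟨0, fun x hx => hx.1.1.le⟩
    set a := sInf U with had
    have hage : 0 ≤ a := le_csInf ⟨y, hy⟩ fun x hx => hx.1.1.le
    have hay : a ≤ y := csInf_le hbdd hy
    have hlt : a < 1 := lt_of_le_of_lt hay hy.1.2
    have hs1 : Ioo a 1 ⊆ U := by
      intro x hx
      obtain ⟨z, hz, hzx⟩ := exists_lt_of_csInf_lt ⟨y, hy⟩ hx.1
      have hx01 : x ∈ Ioo (0:ℝ) 1 := ⟨lt_of_le_of_lt hage hx.1, hx.2⟩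
      exact ⟨hx01, lt_of_lt_of_le hz.2 (hm hz.1 hx01 hzx.le)⟩
    have hs2 : U ⊆ Icc a 1 := fun x hx => ⟨csInf_le hbdd hx, hx.1.2.le⟩
    have hae : U =ᵐ[volume] Ioo a 1 := by
      refine Filter.EventuallyLE.antisymm ?_ hs1.eventuallyLE
      exact hs2.eventuallyLE.trans (Ioo_ae_eq_Icc (μ := volume)).symm.le
    rw [setIntegral_congr_set hae, ← integral_Ioc_eq_integral_Ioo,
      ← intervalIntegral.integral_of_le hlt.le]
    exact ha0 a ⟨hage, hlt⟩
  have hfub : ∫ x in Ioo 0 1, (∫ l in Ioc 0 M, (if l < φ x then r x else 0)) =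
      ∫ l in Ioc 0 M, (∫ x in Ioo 0 1, (if l < φ x then r x else 0)) := by
    apply integral_integral_swap
    have h1 : Integrable (fun z : ℝ × ℝ => r z.1)
        ((volume.restrict (Ioo 0 1)).prod (volume.restrict (Ioc 0 M))) :=
      Integrable.comp_fst hr' _
    have hms : MeasurableSet {z : ℝ × ℝ | z.2 < φ z.1} :=
      measurableSet_lt measurable_snd (hφ.comp measurable_fst)
    refine (h1.indicator hms).congr (Filter.Eventually.of_forall fun z => ?_)
    simp [indicator, Function.uncurry]
  have hin : ∀ x ∈ Ioo (0:ℝ) 1,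
      ∫ l in Ioc 0 M, (if l < φ x then r x else 0) = r x * φ x := by
    intro x hx
    have e1 : (fun l => if l < φ x then r x else 0) = indicator (Iio (φ x)) (fun _ => r x) := by
      ext l; simp [indicator]
    have e2 : Ioc 0 M ∩ Iio (φ x) = Ioo 0 (φ x) := by
      ext l
      simp only [mem_inter_iff, mem_Ioc, mem_Iio, mem_Ioo]
      exact ⟨fun h => ⟨h.1.1, h.2⟩, fun h => ⟨⟨h.1, h.2.le.trans (hM x hx)⟩, h.2⟩⟩
    rw [e1, setIntegral_indicator measurableSet_Iio, e2, setIntegral_const]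
    simp [measureReal_def, h0 x hx, mul_comm]
  rw [← setIntegral_congr_fun measurableSet_Ioo hin, hfub]
  exact integral_nonpos fun l => hU l

open Set MeasureTheory in
lemma mink_sqrt_int (p : ℝ → ℝ) (hp : Measurable p) (hI : IntegrableOn p (Ioc 0 1)) (e : ℝ)
    (he : 0 ≤ e) (hn : ∀ x ∈ Ioo (0:ℝ) 1, 0 ≤ p x) :
    IntegrableOn (fun x => Real.sqrt (p x + e)) (Ioo 0 1) := by
  have h1 : IntegrableOn (fun x => p x + e + 1) (Ioo 0 1) := by
    have : IntegrableOn p (Ioo 0 1) := hI.mono_set Ioo_subset_Ioc_self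
    exact (this.add (integrable_const e)).add (integrable_const 1)
  refine Integrable.mono' h1 (by fun_prop) ?_
  rw [ae_restrict_iff' measurableSet_Ioo]
  refine Filter.Eventually.of_forall fun x hx => ?_
  have := hn x hx
  rw [Real.norm_of_nonneg (Real.sqrt_nonneg _)]
  rw [Real.sqrt_le_left (by linarith)]
  nlinarith


/-- **Of two nested concave ROC curves with common endpoints, the outer one is
shorter in the Minkowski metric.**  Let `f, g : [0,1] → ℝ` be concave,
nondecreasing functions with `f 0 = g 0`, `f 1 = g 1` and `f ≤ g` on `[0,1]`.
Then the Minkowski length `∫₀¹ √(g′ x) dx` of the graph of `g` is at most the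
Minkowski length `∫₀¹ √(f′ x) dx` of the graph of `f`. -/
theorem minkowski_length_outer_le_inner
    (f g : ℝ → ℝ)
    (hf : ConcaveOn ℝ (Set.Icc 0 1) f) (hg : ConcaveOn ℝ (Set.Icc 0 1) g)
    (hfm : MonotoneOn f (Set.Icc 0 1)) (hgm : MonotoneOn g (Set.Icc 0 1))
    (h0 : f 0 = g 0) (h1 : f 1 = g 1)
    (hle : ∀ x ∈ Set.Icc (0:ℝ) 1, f x ≤ g x) :
    ∫ x in (0:ℝ)..1, Real.sqrt (derivWithin g (Set.Icc 0 1) x)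
      ≤ ∫ x in (0:ℝ)..1, Real.sqrt (derivWithin f (Set.Icc 0 1) x) := by

  obtain ⟨p, hpm, hpa, hpn, hpI, hpi, hpe⟩ := mink_right_deriv f hf hfm
  obtain ⟨q, hqm, hqa, hqn, hqI, hqi, hqe⟩ := mink_right_deriv g hg hgm
  have key : ∀ (h s : ℝ → ℝ),
      (∀ᵐ x, x ∈ Set.Ioo (0:ℝ) 1 → derivWithin h (Set.Icc 0 1) x = s x) →
      ∫ x in (0:ℝ)..1, Real.sqrt (derivWithin h (Set.Icc 0 1) x)
        = ∫ x in Set.Ioo 0 1, Real.sqrt (s x) := by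
    intro h s hs
    rw [intervalIntegral.integral_of_le zero_le_one, MeasureTheory.integral_Ioc_eq_integral_Ioo]
    apply MeasureTheory.setIntegral_congr_ae measurableSet_Ioo
    filter_upwards [hs] with x hx hx1
    rw [hx hx1]
  rw [key f p hpe, key g q hqe]
  have hpS := mink_sqrt_int p hpm hpI 0 le_rfl hpn
  have hqS := mink_sqrt_int q hqm hqI 0 le_rfl hqn
  simp only [add_zero] at hpS hqS
  refine le_of_forall_pos_le_add fun d hd => ?_
  set e := d ^ 2 with hedef
  have he : 0 < e := by positivity
  have hsd : Real.sqrt e = d := Real.sqrt_sq hd.le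
  have hpE := mink_sqrt_int p hpm hpI e he.le hpn
  have hqE := mink_sqrt_int q hqm hqI e he.le hqn
  have hrI : MeasureTheory.IntegrableOn (fun x => q x - p x) (Set.Ioc 0 1) := hqI.sub hpI
  set φ : ℝ → ℝ := fun x => 1 / (2 * Real.sqrt (p x + e)) with hφ
  have hφm : Measurable φ := by fun_prop
  have hdpos : ∀ x ∈ Set.Ioo (0:ℝ) 1, d ≤ Real.sqrt (p x + e) := by
    intro x hx
    rw [← hsd]
    exact Real.sqrt_le_sqrt (by linarith [hpn x hx])
  have hφ0 : ∀ x, 0 ≤ φ x := fun x => by positivity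
  have hφM : ∀ x ∈ Set.Ioo (0:ℝ) 1, φ x ≤ 1 / (2 * d) := by
    intro x hx
    have := hdpos x hx
    exact one_div_le_one_div_of_le (by positivity) (by linarith)
  have hφmono : MonotoneOn φ (Set.Ioo 0 1) := by
    intro x hx y hy hxy
    have h1 := hdpos y hy
    have h2 : Real.sqrt (p y + e) ≤ Real.sqrt (p x + e) :=
      Real.sqrt_le_sqrt (by linarith [hpa hx hy hxy])
    exact one_div_le_one_div_of_le (by linarith) (by linarith)
  have hB := mink_bonnet (fun x => q x - p x) φ (1 / (2 * d)) hrI hφm hφmono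
    (fun x _ => hφ0 x) hφM (by
      intro a ha
      have ii : ∀ s : ℝ → ℝ, MeasureTheory.IntegrableOn s (Set.Ioc 0 1) →
          IntervalIntegrable s MeasureTheory.volume a 1 := fun s hs =>
        (intervalIntegrable_iff_integrableOn_Ioc_of_le ha.2.le).2
          (hs.mono_set (Set.Ioc_subset_Ioc_left ha.1.le))
      rw [intervalIntegral.integral_sub (ii q hqI) (ii p hpI), hqi a ha, hpi a ha]
      linarith [hle a ⟨ha.1.le, ha.2.le⟩])
  have hrφ : MeasureTheory.IntegrableOn (fun x => (q x - p x) * φ x) (Set.Ioo 0 1) := by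
    have h1 : MeasureTheory.IntegrableOn (fun x => q x - p x) (Set.Ioo 0 1) :=
      hrI.mono_set Set.Ioo_subset_Ioc_self
    refine MeasureTheory.Integrable.mul_bdd (c := 1 / (2 * d)) h1 hφm.aestronglyMeasurable ?_
    rw [MeasureTheory.ae_restrict_iff' measurableSet_Ioo]
    refine Filter.Eventually.of_forall fun x hx => ?_
    rw [Real.norm_of_nonneg (hφ0 x)]
    exact hφM x hx
  have hdI : MeasureTheory.IntegrableOn (fun _ : ℝ => d) (Set.Ioo (0:ℝ) 1) :=
    MeasureTheory.integrable_const d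
  have hmain : ∫ x in Set.Ioo 0 1, Real.sqrt (q x) ≤
      ∫ x in Set.Ioo 0 1, ((Real.sqrt (p x) + d) + (q x - p x) * φ x) := by
    refine MeasureTheory.setIntegral_mono_on hqS ((hpS.add hdI).add hrφ) measurableSet_Ioo ?_
    intro x hx
    have hq := hqn x hx
    have hp := hpn x hx
    have h1 : Real.sqrt (q x) ≤ Real.sqrt (q x + e) := Real.sqrt_le_sqrt (by linarith)
    have h2 : Real.sqrt (p x + e) ≤ Real.sqrt (p x) + d := by
      rw [Real.sqrt_le_left (by positivity)]
      nlinarith [Real.sq_sqrt hp, Real.sqrt_nonneg (p x)]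
    have h3 : Real.sqrt (q x + e) ≤ Real.sqrt (p x + e) + (q x - p x) * φ x := by
      have hs := hdpos x hx
      set u := Real.sqrt (p x + e) with hu
      set v := Real.sqrt (q x + e) with hv
      have hu2 : u ^ 2 = p x + e := Real.sq_sqrt (by linarith)
      have hv2 : v ^ 2 = q x + e := Real.sq_sqrt (by linarith)
      have hup : 0 < u := by linarith
      have e1 : (q x - p x) * φ x = (v ^ 2 - u ^ 2) / (2 * u) := by
        simp only [hφ]
        rw [hu2, hv2, ← hu]
        ring
      rw [e1, ← sub_le_iff_le_add', le_div_iff₀ (by positivity)]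
      nlinarith [sq_nonneg (v - u)]
    linarith
  have hsum : ∫ x in Set.Ioo 0 1, ((Real.sqrt (p x) + d) + (q x - p x) * φ x)
      = (∫ x in Set.Ioo 0 1, Real.sqrt (p x)) + d + ∫ x in Set.Ioo 0 1, (q x - p x) * φ x := by
    have hpd : MeasureTheory.IntegrableOn (fun x => Real.sqrt (p x) + d) (Set.Ioo 0 1) :=
      hpS.add hdI
    rw [MeasureTheory.integral_add hpd hrφ, MeasureTheory.integral_add hpS hdI]
    simp
  linarith
end

section
/- Let f : [0,1] → ℝ be a concave, nondecreasing function with f(0) = 0 and f(1) = 1. Then the Minkowski length of its graph satisfies ∫₀¹ √(f′(x)) dx ≤ 1, with equality if and only if f(x) = x for all x ∈ [0,1]. (The diagonal of the ROC square is the longest curve from (0,0) to (1,1) in the Minkowski metric.) -/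
open MeasureTheory

/-- **The diagonal of the ROC square is the longest curve from (0,0) to (1,1)
in the Minkowski metric.**  Let `f : [0,1] → ℝ` be a concave, nondecreasing
function with `f 0 = 0` and `f 1 = 1`.  Then the Minkowski length of its graph
satisfies `∫₀¹ √(f′ x) dx ≤ 1`, with equality if and only if `f x = x` for all
`x ∈ [0,1]`. -/
theorem minkowski_length_le_one
    (f : ℝ → ℝ)
    (hf : ConcaveOn ℝ (Set.Icc 0 1) f)
    (hfm : MonotoneOn f (Set.Icc 0 1))
    (h0 : f 0 = 0) (h1 : f 1 = 1) :
    (∫ x in (0:ℝ)..1, Real.sqrt (derivWithin f (Set.Icc 0 1) x)) ≤ 1 ∧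
      ((∫ x in (0:ℝ)..1, Real.sqrt (derivWithin f (Set.Icc 0 1) x)) = 1 ↔
        ∀ x ∈ Set.Icc (0:ℝ) 1, f x = x) := by
  have hI : IntervalIntegrable (deriv f) volume 0 1 := by
    apply MonotoneOn.intervalIntegrable_deriv
    rwa [Set.uIcc_of_le zero_le_one]
  have hsub : ∀ a b : ℝ, 0 ≤ a → a ≤ b → b ≤ 1 →
      ∫ x in a..b, deriv f x ≤ f b - f a := by
    intro a b ha hab hb
    have hm : MonotoneOn f (Set.uIcc a b) := by
      rw [Set.uIcc_of_le hab]
      exact hfm.mono (Set.Icc_subset_Icc ha hb)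
    have h := hm.intervalIntegral_deriv_mem_uIcc
    have hle : f a ≤ f b := hfm ⟨ha, hab.trans hb⟩ ⟨ha.trans hab, hb⟩ hab
    rw [Set.uIcc_of_le (by linarith)] at h
    exact h.2
  have hint : ∀ x ∈ Set.Ioo (0:ℝ) 1, derivWithin f (Set.Icc 0 1) x = deriv f x := by
    intro x hx
    exact derivWithin_of_mem_nhds (Icc_mem_nhds hx.1 hx.2)
  have hnn : ∀ x ∈ Set.Ioo (0:ℝ) 1, 0 ≤ deriv f x := by
    intro x hx
    rw [← hint x hx]
    exact hfm.derivWithin_nonneg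
  have hne : ∀ᵐ x : ℝ ∂volume, x ≠ 1 := by
    simp [ae_iff]
  have heq : (∫ x in (0:ℝ)..1, Real.sqrt (derivWithin f (Set.Icc 0 1) x))
      = ∫ x in (0:ℝ)..1, Real.sqrt (deriv f x) := by
    apply intervalIntegral.integral_congr_ae
    filter_upwards [hne] with x hx hx2
    rw [Set.uIoc_of_le zero_le_one] at hx2
    rw [hint x ⟨hx2.1, lt_of_le_of_ne hx2.2 hx⟩]
  rw [heq]
  have hS : IntervalIntegrable (fun x => Real.sqrt (deriv f x)) volume 0 1 := by
    have hg : IntervalIntegrable (fun x => ‖deriv f x‖ + 1) volume 0 1 :=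
      hI.norm.add intervalIntegrable_const
    refine hg.mono_fun ?_ ?_
    · exact (Real.continuous_sqrt.comp_aestronglyMeasurable hI.aestronglyMeasurable_restrict_uIoc)
    · refine Filter.Eventually.of_forall fun x => ?_
      beta_reduce
      rw [Real.norm_of_nonneg (Real.sqrt_nonneg _), Real.norm_of_nonneg (by positivity)]
      have := le_abs_self (deriv f x)
      have h0 := abs_nonneg (deriv f x)
      rw [Real.norm_eq_abs]
      apply Real.sqrt_le_iff.2
      constructor
      · positivity
      · nlinarith
  have hQ : IntervalIntegrable (fun x => (deriv f x - 2 * Real.sqrt (deriv f x)) + 1) volume 0 1 :=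
    (hI.sub (hS.const_mul 2)).add intervalIntegrable_const
  have hQi : (∫ x in (0:ℝ)..1, ((deriv f x - 2 * Real.sqrt (deriv f x)) + 1))
      = (∫ x in (0:ℝ)..1, deriv f x) - 2 * (∫ x in (0:ℝ)..1, Real.sqrt (deriv f x)) + 1 := by
    rw [intervalIntegral.integral_add (hI.sub (hS.const_mul 2)) intervalIntegrable_const,
      intervalIntegral.integral_sub hI (hS.const_mul 2), intervalIntegral.integral_const_mul]
    simp
  have hsq : ∀ x ∈ Set.Ioo (0:ℝ) 1, (deriv f x - 2 * Real.sqrt (deriv f x)) + 1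
      = (Real.sqrt (deriv f x) - 1) ^ 2 := by
    intro x hx
    nlinarith [Real.sq_sqrt (hnn x hx)]
  have hQae : 0 ≤ᵐ[volume.restrict (Set.Ioc (0:ℝ) 1)]
      (fun x => (deriv f x - 2 * Real.sqrt (deriv f x)) + 1) := by
    filter_upwards [ae_restrict_mem measurableSet_Ioc, ae_restrict_of_ae hne] with x hx hx1
    rw [hsq x ⟨hx.1, lt_of_le_of_ne hx.2 hx1⟩]
    exact sq_nonneg _
  have hQ0 : 0 ≤ ∫ x in (0:ℝ)..1, ((deriv f x - 2 * Real.sqrt (deriv f x)) + 1) :=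
    intervalIntegral.integral_nonneg_of_ae_restrict zero_le_one
      (by rwa [restrict_Ioc_eq_restrict_Icc] at hQae)
  have hD := hsub 0 1 le_rfl zero_le_one le_rfl
  rw [h0, h1] at hD
  refine ⟨by linarith, ?_, ?_⟩
  · intro h
    have hz : ∫ x in (0:ℝ)..1, ((deriv f x - 2 * Real.sqrt (deriv f x)) + 1) = 0 := by
      linarith
    rw [intervalIntegral.integral_eq_zero_iff_of_le_of_nonneg_ae zero_le_one hQae hQ] at hz
    have hd1 : ∀ᵐ x ∂volume, x ∈ Set.Ioc (0:ℝ) 1 → deriv f x = 1 := by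
      have hz' := (ae_restrict_iff' measurableSet_Ioc).1 hz
      filter_upwards [hz', hne] with x hx hx1 hm
      have hm' : x ∈ Set.Ioo (0:ℝ) 1 := ⟨hm.1, lt_of_le_of_ne hm.2 hx1⟩
      have h2 := hx hm
      simp only [Pi.zero_apply] at h2
      rw [hsq x hm'] at h2
      have h3 : Real.sqrt (deriv f x) = 1 := by
        have := pow_eq_zero_iff (two_ne_zero) |>.1 h2
        linarith
      rwa [Real.sqrt_eq_one] at h3
    have hval : ∀ a b : ℝ, 0 ≤ a → a ≤ b → b ≤ 1 → ∫ x in a..b, deriv f x = b - a := by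
      intro a b ha hab hb
      have : ∫ x in a..b, deriv f x = ∫ x in a..b, (1:ℝ) := by
        apply intervalIntegral.integral_congr_ae
        filter_upwards [hd1] with x hx hm
        rw [Set.uIoc_of_le hab] at hm
        exact hx ⟨lt_of_le_of_lt ha hm.1, hm.2.trans hb⟩
      rw [this]; simp
    intro x hx
    have e1 := hsub 0 x le_rfl hx.1 hx.2
    have e2 := hsub x 1 hx.1 hx.2 le_rfl
    rw [hval 0 x le_rfl hx.1 hx.2, h0] at e1
    rw [hval x 1 hx.1 hx.2 le_rfl, h1] at e2
    linarith
  · intro h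
    have : ∫ x in (0:ℝ)..1, Real.sqrt (deriv f x) = ∫ x in (0:ℝ)..1, (1:ℝ) := by
      apply intervalIntegral.integral_congr_ae
      filter_upwards [hne] with x hx hm
      rw [Set.uIoc_of_le zero_le_one] at hm
      have he : f =ᶠ[nhds x] id := by
        filter_upwards [Icc_mem_nhds hm.1 (lt_of_le_of_ne hm.2 hx)] with y hy
        exact h y hy
      rw [he.deriv_eq]; simp
    rw [this]; simp
end

section
/- Let 0 ≤ θ_q ≤ θ_p and θ_p ≤ α ≤ θ_q + π, and set TP(α) = (1 + cos(α − θ_p))/2 and FP(α) = (1 + cos(α − θ_q))/2. Then the classical Bhattacharyya coefficient of the two binary outcome distributions is constant along this arc of the ROC ellipse: √(TP(α)·FP(α)) + √((1 − TP(α))·(1 − FP(α))) = cos((θ_p − θ_q)/2). (The upper arc of the pure-state ROC ellipse is an isoline of the classical Bhattacharyya coefficient.) -/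
/-- **The upper arc of the pure-state ROC ellipse is an isoline of the
classical Bhattacharyya coefficient.**  For `0 ≤ θ_q ≤ θ_p` and
`θ_p ≤ α ≤ θ_q + π`, with `TP(α) = (1 + cos(α − θ_p))/2` and
`FP(α) = (1 + cos(α − θ_q))/2`, the classical Bhattacharyya coefficient of the
two binary outcome distributions is constant along the arc:
`√(TP·FP) + √((1−TP)(1−FP)) = cos((θ_p − θ_q)/2)`. -/
theorem pure_state_ROC_iso_Bhattacharyya (θp θq α : ℝ)
    (hq0 : 0 ≤ θq) (hqp : θq ≤ θp) (hpα : θp ≤ α) (hα : α ≤ θq + Real.pi) :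
    Real.sqrt (((1 + Real.cos (α - θp)) / 2) * ((1 + Real.cos (α - θq)) / 2))
      + Real.sqrt ((1 - (1 + Real.cos (α - θp)) / 2)
          * (1 - (1 + Real.cos (α - θq)) / 2))
      = Real.cos ((θp - θq) / 2) := by
  obtain ⟨x, hx⟩ : ∃ x, x = (α - θp) / 2 := ⟨_, rfl⟩
  obtain ⟨y, hy⟩ : ∃ y, y = (α - θq) / 2 := ⟨_, rfl⟩
  have e1 : α - θp = 2 * x := by rw [hx]; ring
  have e2 : α - θq = 2 * y := by rw [hy]; ring
  have e3 : (θp - θq) / 2 = y - x := by rw [hx, hy]; ring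
  have hpi := Real.pi_pos
  have cx : 0 ≤ Real.cos x := Real.cos_nonneg_of_neg_pi_div_two_le_of_le (by linarith) (by linarith)
  have cy : 0 ≤ Real.cos y := Real.cos_nonneg_of_neg_pi_div_two_le_of_le (by linarith) (by linarith)
  have sx : 0 ≤ Real.sin x := Real.sin_nonneg_of_nonneg_of_le_pi (by linarith) (by linarith)
  have sy : 0 ≤ Real.sin y := Real.sin_nonneg_of_nonneg_of_le_pi (by linarith) (by linarith)
  rw [e1, e2, e3, Real.cos_sub, Real.cos_two_mul, Real.cos_two_mul]
  have h1 : (1 + (2 * Real.cos x ^ 2 - 1)) / 2 * ((1 + (2 * Real.cos y ^ 2 - 1)) / 2)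
      = (Real.cos y * Real.cos x) ^ 2 := by ring
  have h2 : (1 - (1 + (2 * Real.cos x ^ 2 - 1)) / 2) * (1 - (1 + (2 * Real.cos y ^ 2 - 1)) / 2)
      = (Real.sin y * Real.sin x) ^ 2 := by
    rw [mul_pow, Real.sin_sq, Real.sin_sq]; ring
  rw [h1, h2, Real.sqrt_sq (mul_nonneg cy cx), Real.sqrt_sq (mul_nonneg sy sx)]
end

section
/- Let ρ_P and ρ_N be n×n complex density matrices such that neither support contains the other: range(ρ_P) ⊄ range(ρ_N) and range(ρ_N) ⊄ range(ρ_P). Then unambiguous discrimination is possible: there exist positive semidefinite matrices M_p and M_n with M_p + M_n ≤ I (so that M_? = I − M_p − M_n is positive semidefinite and {M_p, M_n, M_?} is a POVM), satisfying Re tr(M_p ρ_N) = 0, Re tr(M_n ρ_P) = 0, Re tr(M_p ρ_P) > 0, and Re tr(M_n ρ_N) > 0. -/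
open scoped ComplexOrder

open Matrix in
lemma sep_aux {n : ℕ} (A B : Matrix (Fin n) (Fin n) ℂ) (hA : A.PosSemidef) (hB : B.PosSemidef)
    (h : ¬ LinearMap.range A.mulVecLin ≤ LinearMap.range B.mulVecLin) :
    ∃ v : Fin n → ℂ, B *ᵥ v = 0 ∧ 0 < star v ⬝ᵥ (A *ᵥ v) := by
  obtain ⟨y, ⟨x, rfl⟩, hy⟩ := SetLike.not_le_iff_exists.mp h
  obtain ⟨f, hf, hfB⟩ := Submodule.exists_le_ker_of_notMem hy
  let w : Fin n → ℂ := fun i => f (Pi.single i 1)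
  have hw : ∀ z, f z = w ⬝ᵥ z := by
    intro z
    rw [LinearMap.pi_apply_eq_sum_univ f z]
    simp only [dotProduct, w, smul_eq_mul]
    refine Finset.sum_congr rfl fun i _ => ?_
    rw [mul_comm]
    congr 2
    ext j
    simp [Pi.single_apply, eq_comm]
  have hvec : ∀ C : Matrix (Fin n) (Fin n) ℂ, C.IsHermitian → C *ᵥ star w = star (w ᵥ* C) := by
    intro C hC
    rw [star_vecMul, hC.eq]
  refine ⟨star w, ?_, ?_⟩
  · rw [hvec B hB.1, star_eq_zero]
    refine dotProduct_eq_zero _ fun z => ?_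
    rw [← dotProduct_mulVec, ← hw]
    exact hfB ⟨z, rfl⟩
  · refine lt_of_le_of_ne (hA.dotProduct_mulVec_nonneg _) fun h0 => hf ?_
    have h1 := (hA.dotProduct_mulVec_zero_iff _).mp h0.symm
    rw [hvec A hA.1, star_eq_zero] at h1
    rw [hw, mulVecLin_apply, dotProduct_mulVec, h1, zero_dotProduct]

open Matrix in
lemma proj_aux {n : ℕ} (A B : Matrix (Fin n) (Fin n) ℂ) (hA : A.PosSemidef) (hB : B.PosSemidef)
    (h : ¬ LinearMap.range A.mulVecLin ≤ LinearMap.range B.mulVecLin) :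
    ∃ M : Matrix (Fin n) (Fin n) ℂ, M.PosSemidef ∧ ((1/2 : ℂ) • (1 - M)).PosSemidef ∧
      (M * B).trace = 0 ∧ 0 < (M * A).trace := by
  obtain ⟨v, hv, hpos⟩ := sep_aux A B hA hB h
  have hv0 : v ≠ 0 := by
    rintro rfl
    simp at hpos
  have hc : 0 < star v ⬝ᵥ v := dotProduct_star_self_pos_iff.mpr hv0
  set c := star v ⬝ᵥ v with hcdef
  have hci : 0 < c⁻¹ := inv_pos.mpr hc
  have hps : (c⁻¹ • vecMulVec v (star v)).PosSemidef :=
    (posSemidef_vecMulVec_self_star v).smul hci.le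
  have htr : ∀ C : Matrix (Fin n) (Fin n) ℂ,
      ((c⁻¹ • vecMulVec v (star v)) * C).trace = c⁻¹ * (star v ⬝ᵥ (C *ᵥ v)) := by
    intro C
    rw [smul_mul, trace_smul, trace_mul_comm, mul_vecMulVec, trace_vecMulVec, dotProduct_comm,
      smul_eq_mul]
  refine ⟨_, hps, ?_, ?_, ?_⟩
  · have hid : (c⁻¹ • vecMulVec v (star v)) * (c⁻¹ • vecMulVec v (star v))
        = c⁻¹ • vecMulVec v (star v) := by
      rw [smul_mul, Matrix.mul_smul, vecMulVec_mul_vecMulVec, ← hcdef, vecMulVec_smul, smul_smul c⁻¹ c,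
        inv_mul_cancel₀ hc.ne', one_smul]
    have h2 := posSemidef_conjTranspose_mul_self (1 - c⁻¹ • vecMulVec v (star v))
    rw [conjTranspose_sub, conjTranspose_one, hps.1.eq] at h2
    rw [sub_mul, mul_sub, mul_sub, hid] at h2
    simp only [one_mul, mul_one, sub_self, sub_zero] at h2
    exact h2.smul (by positivity)
  · rw [htr, hv]; simp
  · rw [htr]; exact mul_pos hci hpos

/-- **If neither support contains the other, unambiguous discrimination is
possible.**  If `range ρ_P ⊄ range ρ_N` and `range ρ_N ⊄ range ρ_P`, then there
exist positive semidefinite `M_p`, `M_n` with `M_p + M_n ≤ I` (so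
`M_? = I − M_p − M_n` is positive semidefinite and `{M_p, M_n, M_?}` is a
POVM), `Re tr(M_p ρ_N) = 0`, `Re tr(M_n ρ_P) = 0`, while `Re tr(M_p ρ_P) > 0`
and `Re tr(M_n ρ_N) > 0`. -/
theorem unambiguous_discrimination_possible
    (n : ℕ) (ρP ρN : Matrix (Fin n) (Fin n) ℂ)
    (hP : ρP.PosSemidef) (hP1 : ρP.trace = 1)
    (hN : ρN.PosSemidef) (hN1 : ρN.trace = 1)
    (hPN : ¬ LinearMap.range ρP.mulVecLin ≤ LinearMap.range ρN.mulVecLin)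
    (hNP : ¬ LinearMap.range ρN.mulVecLin ≤ LinearMap.range ρP.mulVecLin) :
    ∃ Mp Mn : Matrix (Fin n) (Fin n) ℂ,
      Mp.PosSemidef ∧ Mn.PosSemidef ∧ (1 - (Mp + Mn)).PosSemidef ∧
      ((Mp * ρN).trace).re = 0 ∧ ((Mn * ρP).trace).re = 0 ∧
      0 < ((Mp * ρP).trace).re ∧ 0 < ((Mn * ρN).trace).re := by
  obtain ⟨P, hP0, hP2, hPB, hPA⟩ := proj_aux ρP ρN hP hN hPN
  obtain ⟨Q, hQ0, hQ2, hQB, hQA⟩ := proj_aux ρN ρP hN hP hNP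
  have hh : (0 : ℂ) < 1 / 2 := by positivity
  refine ⟨(1/2 : ℂ) • P, (1/2 : ℂ) • Q, hP0.smul hh.le, hQ0.smul hh.le, ?_, ?_, ?_, ?_, ?_⟩
  · convert hP2.add hQ2 using 1
    module
  · rw [Matrix.smul_mul, Matrix.trace_smul, hPB]; simp
  · rw [Matrix.smul_mul, Matrix.trace_smul, hQB]; simp
  · rw [Matrix.smul_mul, Matrix.trace_smul, smul_eq_mul]
    exact (Complex.lt_def.mp (mul_pos hh hPA)).1
  · rw [Matrix.smul_mul, Matrix.trace_smul, smul_eq_mul]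
    exact (Complex.lt_def.mp (mul_pos hh hQA)).1
end

section
/- Let Φ be a quantum channel on n×n complex matrices given in Kraus form, Φ(ρ) = Σᵢ Kᵢ ρ Kᵢ* with finitely many n×n Kraus operators satisfying Σᵢ Kᵢ* Kᵢ = I. Then for any density matrices ρ_N, ρ_P, the ROC region of the output states is contained in that of the input states: R(Φ(ρ_N), Φ(ρ_P)) ⊆ R(ρ_N, ρ_P). (In the Heisenberg picture a channel maps each measurement operator 0 ≤ M ≤ I to Φ*(M) = Σᵢ Kᵢ* M Kᵢ, which again satisfies 0 ≤ Φ*(M) ≤ I and reproduces the same ROC point on the input states.) -/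
open scoped ComplexOrder Matrix

/-- The accessible ROC region of two `n × n` density matrices `ρ_N, ρ_P`: the
set of points `(Re tr(M ρ_N), Re tr(M ρ_P))` as `M` ranges over all matrices
with `0 ≤ M ≤ I` in the Loewner order. -/
def ROCregion (n : ℕ) (ρN ρP : Matrix (Fin n) (Fin n) ℂ) : Set (ℝ × ℝ) :=
  {xy | ∃ M : Matrix (Fin n) (Fin n) ℂ,
    M.PosSemidef ∧ (1 - M).PosSemidef ∧
    xy = (((M * ρN).trace).re, ((M * ρP).trace).re)}

/-- **Quantum channels shrink the ROC region.**  If `Φ(ρ) = Σᵢ Kᵢ ρ Kᵢᴴ` is a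
quantum channel in Kraus form (`Σᵢ Kᵢᴴ Kᵢ = I`), then for any density matrices
`ρ_N, ρ_P` the ROC region of the output states is contained in that of the
input states: `R(Φ(ρ_N), Φ(ρ_P)) ⊆ R(ρ_N, ρ_P)`. -/
theorem ROCregion_mono_under_channel
    (n : ℕ) (ρN ρP : Matrix (Fin n) (Fin n) ℂ)
    (hN : ρN.PosSemidef) (hN1 : ρN.trace = 1)
    (hP : ρP.PosSemidef) (hP1 : ρP.trace = 1)
    (ι : Type) [Fintype ι] (K : ι → Matrix (Fin n) (Fin n) ℂ)
    (hK : ∑ i, (K i)ᴴ * K i = 1) :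
    ROCregion n (∑ i, K i * ρN * (K i)ᴴ) (∑ i, K i * ρP * (K i)ᴴ)
      ⊆ ROCregion n ρN ρP := by
  have key : ∀ M ρ : Matrix (Fin n) (Fin n) ℂ,
      (M * ∑ i, K i * ρ * (K i)ᴴ).trace = ((∑ i, (K i)ᴴ * M * K i) * ρ).trace := by
    intro M ρ
    rw [Finset.mul_sum, Finset.sum_mul, Matrix.trace_sum, Matrix.trace_sum]
    refine Finset.sum_congr rfl fun i _ => ?_
    rw [← Matrix.mul_assoc, Matrix.trace_mul_comm]
    simp only [Matrix.mul_assoc]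
  rintro xy ⟨M, hM, hM1, rfl⟩
  refine ⟨∑ i, (K i)ᴴ * M * K i, ?_, ?_, ?_⟩
  · exact Matrix.posSemidef_sum _ fun i _ => hM.conjTranspose_mul_mul_same (K i)
  · have h : 1 - ∑ i, (K i)ᴴ * M * K i = ∑ i, (K i)ᴴ * (1 - M) * K i := by
      rw [← hK, ← Finset.sum_sub_distrib]
      refine Finset.sum_congr rfl fun i _ => ?_
      rw [hK, Matrix.mul_sub, Matrix.sub_mul, Matrix.mul_one]
    rw [h]
    exact Matrix.posSemidef_sum _ fun i _ => hM1.conjTranspose_mul_mul_same (K i)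
  · rw [key, key]
end

section
/- Let ρ_P and ρ_N be n×n complex density matrices. The quantum Bhattacharyya coefficient B(ρ_P, ρ_N) is zero if and only if the two states can be distinguished with certainty, i.e., the two density matrices have disjoint supports (equivalently ρ_P · ρ_N = 0); and B(ρ_P, ρ_N) = 1 if and only if ρ_P = ρ_N. -/
open scoped ComplexOrder Matrix

/-- The upper boundary function of the ROC region `R(ρ_N, ρ_P)`:
`f x = sup { y | (x, y) ∈ R(ρ_N, ρ_P) }`. -/
noncomputable def rocUpper (n : ℕ) (ρN ρP : Matrix (Fin n) (Fin n) ℂ) : ℝ → ℝ :=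
  fun x => sSup {y : ℝ | (x, y) ∈ ROCregion n ρN ρP}

/-- The quantum Bhattacharyya coefficient of `ρ_P` and `ρ_N`: the Minkowski
length `∫₀¹ √(f′(x)) dx` of the optimal ROC curve `f = rocUpper n ρN ρP`. -/
noncomputable def qBhattacharyya (n : ℕ) (ρP ρN : Matrix (Fin n) (Fin n) ℂ) : ℝ :=
  ∫ x in (0:ℝ)..1, Real.sqrt (deriv (rocUpper n ρN ρP) x)


lemma aux_spec {n : ℕ} {A : Matrix (Fin n) (Fin n) ℂ} (hA : A.PosSemidef) :
    ∃ (U : Matrix (Fin n) (Fin n) ℂ) (d : Fin n → ℝ), Uᴴ * U = 1 ∧ U * Uᴴ = 1 ∧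
      (∀ i, 0 ≤ d i) ∧ A = U * Matrix.diagonal (fun i => (d i : ℂ)) * Uᴴ ∧
      A.trace = ∑ i, (d i : ℂ) := by
  refine ⟨hA.1.eigenvectorUnitary, hA.1.eigenvalues, ?_, ?_, hA.eigenvalues_nonneg, ?_, ?_⟩
  · exact Unitary.coe_star_mul_self hA.1.eigenvectorUnitary
  · exact Unitary.coe_mul_star_self hA.1.eigenvectorUnitary
  · exact hA.1.spectral_theorem
  · exact hA.1.trace_eq_sum_eigenvalues

lemma aux_factor {n : ℕ} {A : Matrix (Fin n) (Fin n) ℂ} (hA : A.PosSemidef) :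
    ∃ B : Matrix (Fin n) (Fin n) ℂ, A = Bᴴ * B := by
  obtain ⟨U, d, h1, h2, hd, hA', -⟩ := aux_spec hA
  refine ⟨Matrix.diagonal (fun i => ((Real.sqrt (d i) : ℝ) : ℂ)) * Uᴴ, ?_⟩
  have : (Matrix.diagonal (fun i => ((Real.sqrt (d i) : ℝ) : ℂ)))ᴴ *
      Matrix.diagonal (fun i => ((Real.sqrt (d i) : ℝ) : ℂ)) =
      Matrix.diagonal (fun i => (d i : ℂ)) := by
    rw [Matrix.diagonal_conjTranspose, Matrix.diagonal_mul_diagonal]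
    congr 1
    ext i
    simp only [Pi.star_apply, RCLike.star_def, Complex.conj_ofReal]
    rw [← Complex.ofReal_mul, Real.mul_self_sqrt (hd i)]
  rw [Matrix.conjTranspose_mul, Matrix.conjTranspose_conjTranspose, hA', ← this]
  simp only [Matrix.mul_assoc]

lemma aux_tr_eq {n : ℕ} (A B : Matrix (Fin n) (Fin n) ℂ) :
    ((Aᴴ * A) * (Bᴴ * B)).trace = ((A * Bᴴ)ᴴ * (A * Bᴴ)).trace := by
  rw [Matrix.conjTranspose_mul, Matrix.conjTranspose_conjTranspose, ← Matrix.mul_assoc,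
    Matrix.trace_mul_comm]
  simp only [Matrix.mul_assoc]

lemma aux_tr_nonneg {n : ℕ} {A B : Matrix (Fin n) (Fin n) ℂ} (hA : A.PosSemidef)
    (hB : B.PosSemidef) : 0 ≤ (A * B).trace.re := by
  obtain ⟨A, rfl⟩ := aux_factor hA
  obtain ⟨B, rfl⟩ := aux_factor hB
  rw [aux_tr_eq]
  have := (Matrix.posSemidef_conjTranspose_mul_self (A * Bᴴ)).trace_nonneg
  exact (Complex.le_def.1 this).1

lemma aux_tr_zero {n : ℕ} {A B : Matrix (Fin n) (Fin n) ℂ} (hA : A.PosSemidef)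
    (hB : B.PosSemidef) (h : (A * B).trace.re = 0) : A * B = 0 := by
  obtain ⟨A, rfl⟩ := aux_factor hA
  obtain ⟨B, rfl⟩ := aux_factor hB
  rw [aux_tr_eq] at h
  have := (Matrix.posSemidef_conjTranspose_mul_self (A * Bᴴ)).trace_nonneg
  have h0 : ((A * Bᴴ)ᴴ * (A * Bᴴ)).trace = 0 := by
    apply Complex.ext
    · exact h
    · exact (Complex.le_def.1 this).2.symm
  rw [Matrix.trace_conjTranspose_mul_self_eq_zero_iff] at h0
  calc Aᴴ * A * (Bᴴ * B) = Aᴴ * (A * Bᴴ) * B := by simp only [Matrix.mul_assoc]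
    _ = 0 := by rw [h0]; simp

lemma aux_diag_psd {n : ℕ} (U : Matrix (Fin n) (Fin n) ℂ) (d : Fin n → ℝ) (hd : ∀ i, 0 ≤ d i) :
    (U * Matrix.diagonal (fun i => (d i : ℂ)) * Uᴴ).PosSemidef := by
  apply Matrix.PosSemidef.mul_mul_conjTranspose_same
  apply Matrix.PosSemidef.diagonal
  intro i
  simpa using hd i

lemma aux_one_sub_diag {n : ℕ} (U : Matrix (Fin n) (Fin n) ℂ) (hU : U * Uᴴ = 1) (d : Fin n → ℝ) :
    1 - (U * Matrix.diagonal (fun i => (d i : ℂ)) * Uᴴ) =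
      U * Matrix.diagonal (fun i => ((1 - d i : ℝ) : ℂ)) * Uᴴ := by
  have : Matrix.diagonal (fun i => ((1 - d i : ℝ) : ℂ)) =
      1 - Matrix.diagonal (fun i => (d i : ℂ)) := by
    rw [← Matrix.diagonal_one, Matrix.diagonal_sub]
    congr 1; ext i; simp
  rw [this, Matrix.mul_sub, Matrix.sub_mul, Matrix.mul_one, hU]

lemma aux_one_sub {n : ℕ} {A : Matrix (Fin n) (Fin n) ℂ} (hA : A.PosSemidef)
    (h1 : A.trace = 1) : (1 - A).PosSemidef := by
  obtain ⟨U, d, hU, hU', hd, rfl, ht⟩ := aux_spec hA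
  rw [aux_one_sub_diag U hU']
  apply aux_diag_psd
  intro i
  rw [h1] at ht
  have ht' : (1:ℝ) = ∑ i, d i := by exact_mod_cast ht
  have := Finset.single_le_sum (f := d) (fun j _ => hd j) (Finset.mem_univ i)
  linarith

lemma aux_proj {n : ℕ} {A : Matrix (Fin n) (Fin n) ℂ} (hA : A.PosSemidef) :
    ∃ M G : Matrix (Fin n) (Fin n) ℂ, M.PosSemidef ∧ (1 - M).PosSemidef ∧ M * A = A ∧
      M = G * A := by
  obtain ⟨U, d, hU, hU', hd, rfl, ht⟩ := aux_spec hA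
  have key : ∀ D E : Matrix (Fin n) (Fin n) ℂ, (U * D * Uᴴ) * (U * E * Uᴴ) =
      U * (D * E) * Uᴴ := by
    intro D E
    calc (U * D * Uᴴ) * (U * E * Uᴴ) = U * D * (Uᴴ * U) * E * Uᴴ := by
          simp only [Matrix.mul_assoc]
      _ = _ := by rw [hU]; simp only [Matrix.mul_assoc, Matrix.mul_one]
  refine ⟨U * Matrix.diagonal (fun i => (((if d i = 0 then 0 else 1 : ℝ)) : ℂ)) * Uᴴ,
    U * Matrix.diagonal (fun i => (((d i)⁻¹ : ℝ) : ℂ)) * Uᴴ, ?_, ?_, ?_, ?_⟩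
  · apply aux_diag_psd
    intro i; split_ifs <;> norm_num
  · rw [aux_one_sub_diag U hU']
    apply aux_diag_psd
    intro i; split_ifs <;> norm_num
  · rw [key, Matrix.diagonal_mul_diagonal]
    congr 3; ext i
    by_cases h : d i = 0 <;> simp [h]
  · rw [key, Matrix.diagonal_mul_diagonal]
    congr 3; ext i
    by_cases h : d i = 0 <;> simp [h]

lemma aux_sq {n : ℕ} {M : Matrix (Fin n) (Fin n) ℂ} (hM : M.PosSemidef)
    (hK : (1 - M).PosSemidef) : (M - M * M).PosSemidef := by
  have h1 := hK.conjTranspose_mul_mul_same M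
  have h2 := hM.conjTranspose_mul_mul_same (1 - M)
  rw [hM.1.eq] at h1
  rw [hK.1.eq] at h2
  have := h1.add h2
  convert this using 1
  noncomm_ring

lemma aux_bound {n : ℕ} {M P N : Matrix (Fin n) (Fin n) ℂ} (hM : M.PosSemidef)
    (hK : (1 - M).PosSemidef) (hP : P.PosSemidef) (hP' : (1 - P).PosSemidef)
    (hN : N.PosSemidef) (hN' : (1 - N).PosSemidef) :
    (P * N).trace.re ≤ 2 * ((M * N).trace.re + ((1 - M) * P).trace.re) := by
  have hsq2 : ((1 - M) - (1 - M) * (1 - M)).PosSemidef := by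
    apply aux_sq hK; rwa [sub_sub_cancel]
  have e1 := aux_tr_nonneg (aux_sq hM hK) hN
  have e2 := aux_tr_nonneg hsq2 hP
  have h3 := hP'.conjTranspose_mul_mul_same M
  rw [hM.1.eq] at h3
  have e3 := aux_tr_nonneg h3 hN
  have h4 := hP.conjTranspose_mul_mul_same (1 - M)
  rw [hK.1.eq] at h4
  have e4 := aux_tr_nonneg h4 hN'
  have h5 := hP.conjTranspose_mul_mul_same (M - (1 - M))
  rw [(hM.1.sub hK.1).eq] at h5
  have e5 := aux_tr_nonneg h5 hN
  generalize hKM : 1 - M = K at *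
  have hMK : M + K = 1 := by rw [← hKM]; abel
  have hPN : P * N = (M + K) * P * (M + K) * N := by rw [hMK]; simp
  have hc : (K * P * K).trace = (K * K * P).trace := by
    rw [Matrix.trace_mul_comm, ← Matrix.mul_assoc]
  rw [hPN]
  simp only [Matrix.mul_sub, Matrix.sub_mul, Matrix.mul_add, Matrix.add_mul, Matrix.trace_sub,
    Matrix.trace_add, Matrix.mul_one, Complex.sub_re, Complex.add_re, hc] at *
  linarith

open MeasureTheory in
lemma an_ae {p : ℝ → Prop} (h : ∀ᵐ x ∂(volume.restrict (Set.Ioo (0:ℝ) 1)), p x) {a b : ℝ}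
    (ha : 0 ≤ a) (hb : b ≤ 1) (hab : a < b) : ∃ t, a < t ∧ t < b ∧ p t := by
  rw [ae_restrict_iff' measurableSet_Ioo] at h
  by_contra hcon
  push Not at hcon
  have hsub : Set.Ioo a b ⊆ {x | ¬ (x ∈ Set.Ioo (0:ℝ) 1 → p x)} := by
    intro x hx hp
    exact hcon x hx.1 hx.2 (hp ⟨lt_of_le_of_lt ha hx.1, lt_of_lt_of_le hx.2 hb⟩)
  have h0 : volume (Set.Ioo a b) = 0 := measure_mono_null hsub (ae_iff.1 h)
  rw [Real.volume_Ioo, ENNReal.ofReal_eq_zero] at h0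
  linarith

open MeasureTheory in
lemma an_diff {f : ℝ → ℝ} (hf : MonotoneOn f (Set.Icc 0 1)) :
    ∀ᵐ x ∂(volume.restrict (Set.Ioo (0:ℝ) 1)), x ∈ Set.Ioo (0:ℝ) 1 ∧ DifferentiableAt ℝ f x := by
  rw [ae_restrict_iff' measurableSet_Ioo]
  filter_upwards [(hf.mono Set.Ioo_subset_Icc_self).ae_differentiableWithinAt_of_mem] with x hx hx'
  exact ⟨hx', (hx hx').differentiableAt (Ioo_mem_nhds hx'.1 hx'.2)⟩

lemma an_nonneg {f : ℝ → ℝ} (hf : MonotoneOn f (Set.Icc 0 1)) {t : ℝ} (ht : t ∈ Set.Ioo (0:ℝ) 1) :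
    0 ≤ deriv f t := by
  rw [← derivWithin_of_isOpen isOpen_Ioo ht]
  exact (hf.mono Set.Ioo_subset_Icc_self).derivWithin_nonneg

open MeasureTheory in
lemma an_int {f : ℝ → ℝ} (hf : MonotoneOn f (Set.Icc 0 1)) :
    Integrable (deriv f) (volume.restrict (Set.Ioo (0:ℝ) 1)) := by
  have := MonotoneOn.intervalIntegrable_deriv (f := f) (a := 0) (b := 1)
    (by rwa [Set.uIcc_of_le zero_le_one])
  exact (intervalIntegrable_iff_integrableOn_Ioo_of_le zero_le_one).1 this

open MeasureTheory in
lemma an_int_sqrt {f : ℝ → ℝ} (hf : MonotoneOn f (Set.Icc 0 1)) :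
    Integrable (fun x => Real.sqrt (deriv f x)) (volume.restrict (Set.Ioo (0:ℝ) 1)) := by
  refine Integrable.mono' (g := fun x => 1 + ‖deriv f x‖)
    ((integrable_const _).add (an_int hf).norm)
    (Real.continuous_sqrt.comp_aestronglyMeasurable (an_int hf).aestronglyMeasurable) ?_
  refine Filter.Eventually.of_forall fun x => ?_
  rw [Real.norm_of_nonneg (Real.sqrt_nonneg _), Real.norm_eq_abs]
  apply Real.sqrt_le_iff.2
  constructor
  · positivity
  · nlinarith [le_abs_self (deriv f x), abs_nonneg (deriv f x)]

open MeasureTheory in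
lemma an_conv (g : ℝ → ℝ) : ∫ x in (0:ℝ)..1, g x = ∫ x in Set.Ioo (0:ℝ) 1, g x := by
  rw [intervalIntegral.integral_of_le zero_le_one, integral_Ioc_eq_integral_Ioo]

open MeasureTheory in
lemma an_zero {f : ℝ → ℝ} (hf : MonotoneOn f (Set.Icc 0 1)) (hc : ConcaveOn ℝ (Set.Icc 0 1) f)
    (h1 : f 1 = 1) (hB : ∫ x in (0:ℝ)..1, Real.sqrt (deriv f x) = 0) {ε : ℝ} (h0 : 0 < ε)
    (hε : ε ≤ 1) : ∃ t, 0 < t ∧ t < ε ∧ 1 ≤ f t := by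
  rw [an_conv, integral_eq_zero_iff_of_nonneg (fun x => Real.sqrt_nonneg _) (an_int_sqrt hf)] at hB
  obtain ⟨t, ht0, ht1, ht2, ⟨htm, htd⟩⟩ := an_ae (hB.and (an_diff hf)) le_rfl hε h0
  refine ⟨t, ht0, ht1, ?_⟩
  have hd : deriv f t ≤ 0 := Real.sqrt_eq_zero'.1 ht2
  have hs := hc.slope_le_of_hasDerivAt (Set.Ioo_subset_Icc_self htm)
    (Set.right_mem_Icc.2 zero_le_one) htm.2 htd.hasDerivAt
  have hs' := hs.trans hd
  rw [slope_def_field, div_nonpos_iff] at hs'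
  rcases hs' with h | h <;> linarith [htm.2, h.1, h.2]

open MeasureTheory in
lemma an_one {f : ℝ → ℝ} (hf : MonotoneOn f (Set.Icc 0 1)) (hc : ConcaveOn ℝ (Set.Icc 0 1) f)
    (h1 : f 1 = 1) (hf0 : 0 ≤ f 0)
    (hB : ∫ x in (0:ℝ)..1, Real.sqrt (deriv f x) = 1) {x : ℝ} (hx : x ∈ Set.Icc (0:ℝ) 1) :
    f x ≤ x := by
  have hI : ∫ x in (0:ℝ)..1, deriv f x ≤ 1 := by
    have := MonotoneOn.intervalIntegral_deriv_mem_uIcc (f := f) (a := 0) (b := 1)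
      (by rwa [Set.uIcc_of_le zero_le_one])
    have hm := hf (Set.left_mem_Icc.2 zero_le_one) (Set.right_mem_Icc.2 zero_le_one) zero_le_one
    rw [Set.uIcc_of_le (by linarith)] at this
    linarith [this.2]
  rw [an_conv] at hB hI
  have hnn : ∀ᵐ x ∂(volume.restrict (Set.Ioo (0:ℝ) 1)),
      (Real.sqrt (deriv f x) - 1) ^ 2 = deriv f x - 2 * Real.sqrt (deriv f x) + 1 := by
    filter_upwards [an_diff hf] with x hx
    have := Real.sq_sqrt (an_nonneg hf hx.1)
    nlinarith
  have hint : Integrable (fun x => deriv f x - 2 * Real.sqrt (deriv f x) + 1)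
      (volume.restrict (Set.Ioo (0:ℝ) 1)) :=
    ((an_int hf).sub ((an_int_sqrt hf).const_mul 2)).add (integrable_const _)
  have hval : ∫ x in Set.Ioo (0:ℝ) 1, (Real.sqrt (deriv f x) - 1) ^ 2 ≤ 0 := by
    have hsub : Integrable (fun x => deriv f x - 2 * Real.sqrt (deriv f x))
        (volume.restrict (Set.Ioo (0:ℝ) 1)) := (an_int hf).sub ((an_int_sqrt hf).const_mul 2)
    rw [integral_congr_ae hnn, integral_add hsub
      (integrable_const _), integral_sub (an_int hf) ((an_int_sqrt hf).const_mul 2),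
      integral_const_mul, hB]
    simp
    linarith
  have hz : ∫ x in Set.Ioo (0:ℝ) 1, (Real.sqrt (deriv f x) - 1) ^ 2 = 0 :=
    le_antisymm hval (integral_nonneg fun x => sq_nonneg _)
  rw [integral_eq_zero_iff_of_nonneg (fun x => sq_nonneg _)
    (hint.congr (hnn.mono fun x hx => hx.symm))] at hz
  rcases eq_or_lt_of_le hx.2 with rfl | hx1
  · exact h1.le
  apply le_of_forall_pos_le_add
  intro ε hε
  obtain ⟨t, ht0, ht1, ht2, ⟨htm, htd⟩⟩ := an_ae (hz.and (an_diff hf)) (a := max x (1 - ε))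
    (le_max_of_le_left hx.1) le_rfl (max_lt hx1 (by linarith))
  have hxt : x < t := lt_of_le_of_lt (le_max_left _ _) ht0
  have het : 1 - ε < t := lt_of_le_of_lt (le_max_right _ _) ht0
  have hd : deriv f t = 1 := by
    have h2 : (Real.sqrt (deriv f t) - 1) ^ 2 = 0 := ht2
    have h3 : Real.sqrt (deriv f t) = 1 := by
      have := pow_eq_zero_iff (two_ne_zero) |>.1 h2
      linarith
    exact Real.sqrt_eq_one.1 h3
  have hs := hc.le_slope_of_hasDerivAt hx (Set.Ioo_subset_Icc_self htm) hxt htd.hasDerivAt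
  rw [hd, slope_def_field, le_div_iff₀ (by linarith)] at hs
  have hft := hf (Set.Ioo_subset_Icc_self htm) (Set.right_mem_Icc.2 zero_le_one) ht1.le
  linarith

lemma roc_le_one {n : ℕ} {M P : Matrix (Fin n) (Fin n) ℂ} (hK : (1 - M).PosSemidef)
    (hP : P.PosSemidef) (hP1 : P.trace = 1) : (M * P).trace.re ≤ 1 := by
  have := aux_tr_nonneg hK hP
  rw [Matrix.sub_mul, Matrix.one_mul, Matrix.trace_sub, hP1] at this
  simpa using this

lemma roc_bdd {n : ℕ} {P N : Matrix (Fin n) (Fin n) ℂ}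
    (hP : P.PosSemidef) (hP1 : P.trace = 1) (x : ℝ) :
    BddAbove {y : ℝ | (x, y) ∈ ROCregion n N P} := by
  refine ⟨1, ?_⟩
  rintro y ⟨M, hM, hK, h⟩
  rw [Prod.mk.injEq] at h
  rw [h.2]
  exact roc_le_one hK hP hP1

lemma psd_real_smul {n : ℕ} {M : Matrix (Fin n) (Fin n) ℂ} (hM : M.PosSemidef) {a : ℝ}
    (ha : 0 ≤ a) : ((a : ℂ) • M).PosSemidef := by
  apply hM.smul
  exact_mod_cast ha

lemma tr_real_smul {n : ℕ} (M P : Matrix (Fin n) (Fin n) ℂ) (a : ℝ) :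
    (((a : ℂ) • M) * P).trace.re = a * (M * P).trace.re := by
  simp [Matrix.trace_smul]

/-- convexity of the region -/
lemma roc_convex {n : ℕ} {P N : Matrix (Fin n) (Fin n) ℂ} {x y x' y' a b : ℝ}
    (h : (x, y) ∈ ROCregion n N P) (h' : (x', y') ∈ ROCregion n N P) (ha : 0 ≤ a) (hb : 0 ≤ b)
    (hab : a + b = 1) : (a * x + b * x', a * y + b * y') ∈ ROCregion n N P := by
  obtain ⟨M, hM, hK, e⟩ := h
  obtain ⟨M', hM', hK', e'⟩ := h'
  rw [Prod.mk.injEq] at e e'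
  refine ⟨(a : ℂ) • M + (b : ℂ) • M', (psd_real_smul hM ha).add (psd_real_smul hM' hb), ?_, ?_⟩
  · have := (psd_real_smul hK ha).add (psd_real_smul hK' hb)
    convert this using 1
    rw [smul_sub, smul_sub]
    have : (1 : Matrix (Fin n) (Fin n) ℂ) = (a : ℂ) • 1 + (b : ℂ) • 1 := by
      rw [← add_smul, ← Complex.ofReal_add, hab]; simp
    nth_rewrite 1 [this]
    abel
  · rw [Matrix.add_mul, Matrix.add_mul, Matrix.trace_add, Matrix.trace_add, Complex.add_re,
      Complex.add_re, tr_real_smul, tr_real_smul, tr_real_smul, tr_real_smul, e.1, e.2, e'.1, e'.2]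

lemma roc_one {n : ℕ} {P N : Matrix (Fin n) (Fin n) ℂ} (hP1 : P.trace = 1) (hN1 : N.trace = 1) :
    ((1:ℝ), (1:ℝ)) ∈ ROCregion n N P :=
  ⟨1, Matrix.PosSemidef.one, by simpa using Matrix.PosSemidef.zero, by simp [hP1, hN1]⟩

lemma roc_zero {n : ℕ} {P N : Matrix (Fin n) (Fin n) ℂ} : ((0:ℝ), (0:ℝ)) ∈ ROCregion n N P :=
  ⟨0, Matrix.PosSemidef.zero, by simpa using Matrix.PosSemidef.one, by simp⟩

lemma roc_diag {n : ℕ} {P N : Matrix (Fin n) (Fin n) ℂ} (hP1 : P.trace = 1) (hN1 : N.trace = 1)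
    {x : ℝ} (hx : x ∈ Set.Icc (0:ℝ) 1) : (x, x) ∈ ROCregion n N P := by
  have := roc_convex (roc_one hP1 hN1) (roc_zero (P := P) (N := N)) hx.1
    (b := 1 - x) (by linarith [hx.2]) (by ring)
  simpa using this

lemma upper_le_one {n : ℕ} {P N : Matrix (Fin n) (Fin n) ℂ} (hP : P.PosSemidef)
    (hP1 : P.trace = 1) (hN1 : N.trace = 1) {x : ℝ} (hx : x ∈ Set.Icc (0:ℝ) 1) :
    rocUpper n N P x ≤ 1 := by
  apply csSup_le ⟨x, roc_diag hP1 hN1 hx⟩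
  rintro y ⟨M, hM, hK, h⟩
  rw [Prod.mk.injEq] at h
  rw [h.2]
  exact roc_le_one hK hP hP1

lemma le_upper {n : ℕ} {P N : Matrix (Fin n) (Fin n) ℂ} (hP : P.PosSemidef)
    (hP1 : P.trace = 1) {x y : ℝ} (h : (x, y) ∈ ROCregion n N P) : y ≤ rocUpper n N P x :=
  le_csSup (roc_bdd hP hP1 x) h

lemma upper_approx {n : ℕ} {P N : Matrix (Fin n) (Fin n) ℂ} (hP1 : P.trace = 1)
    (hN1 : N.trace = 1) {x : ℝ} (hx : x ∈ Set.Icc (0:ℝ) 1) {ε : ℝ} (hε : 0 < ε) :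
    ∃ y, (x, y) ∈ ROCregion n N P ∧ rocUpper n N P x - ε < y :=
  exists_lt_of_lt_csSup (s := {y : ℝ | (x, y) ∈ ROCregion n N P}) ⟨x, roc_diag hP1 hN1 hx⟩
    (sub_lt_self _ hε)

lemma upper_concave {n : ℕ} {P N : Matrix (Fin n) (Fin n) ℂ} (hP : P.PosSemidef)
    (hP1 : P.trace = 1) (hN1 : N.trace = 1) :
    ConcaveOn ℝ (Set.Icc 0 1) (rocUpper n N P) := by
  refine ⟨convex_Icc 0 1, ?_⟩
  intro x hx x' hx' a b ha hb hab
  apply le_of_forall_pos_le_add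
  intro ε hε
  obtain ⟨y, hy, hy'⟩ := upper_approx hP1 hN1 hx hε
  obtain ⟨z, hz, hz'⟩ := upper_approx hP1 hN1 hx' hε
  have := le_upper hP hP1 (roc_convex hy hz ha hb hab)
  simp only [smul_eq_mul]
  nlinarith

lemma upper_one {n : ℕ} {P N : Matrix (Fin n) (Fin n) ℂ} (hP : P.PosSemidef)
    (hP1 : P.trace = 1) (hN1 : N.trace = 1) : rocUpper n N P 1 = 1 :=
  le_antisymm (upper_le_one hP hP1 hN1 (by simp)) (le_upper hP hP1 (roc_one hP1 hN1))

lemma upper_mono {n : ℕ} {P N : Matrix (Fin n) (Fin n) ℂ} (hP : P.PosSemidef)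
    (hP1 : P.trace = 1) (hN1 : N.trace = 1) :
    MonotoneOn (rocUpper n N P) (Set.Icc 0 1) := by
  intro x hx y hy hxy
  rcases eq_or_lt_of_le hxy with rfl | hlt
  · exact le_rfl
  have h1 : 0 < 1 - x := by linarith [hy.2]
  have ha' : 0 ≤ (1 - y) / (1 - x) := div_nonneg (by linarith [hy.2]) h1.le
  have hb' : 0 ≤ (y - x) / (1 - x) := div_nonneg (by linarith) h1.le
  have hab' : (1 - y) / (1 - x) + (y - x) / (1 - x) = 1 := by field_simp; ring
  have hc := (upper_concave (N := N) hP hP1 hN1).2 hx (Set.right_mem_Icc.2 zero_le_one)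
    ha' hb' hab'
  have he : ((1 - y) / (1 - x)) • x + ((y - x) / (1 - x)) • (1:ℝ) = y := by
    simp only [smul_eq_mul]; field_simp; ring
  rw [he, upper_one hP hP1 hN1] at hc
  have hle := upper_le_one hP hP1 hN1 hx
  have hs : (1 - y) / (1 - x) = 1 - (y - x) / (1 - x) := by field_simp; ring
  have hnn : 0 ≤ (y - x) / (1 - x) := div_nonneg (by linarith) h1.le
  rw [hs] at hc
  simp only [smul_eq_mul] at hc
  nlinarith

lemma qB_of_eqOn {n : ℕ} {P N : Matrix (Fin n) (Fin n) ℂ} {g : ℝ → ℝ} {c : ℝ}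
    (h : Set.EqOn (rocUpper n N P) g (Set.Ioo 0 1)) (hg : ∀ x, deriv g x = c) :
    qBhattacharyya n P N = Real.sqrt c := by
  rw [qBhattacharyya, an_conv, MeasureTheory.setIntegral_congr_fun (g := fun _ => Real.sqrt c)
    measurableSet_Ioo]
  · simp
  · intro x hx
    have : rocUpper n N P =ᶠ[nhds x] g :=
      Filter.eventuallyEq_of_mem (Ioo_mem_nhds hx.1 hx.2) h
    simp only [this.deriv_eq, hg]

/-- **Extremal values of the quantum Bhattacharyya coefficient.**  For density
matrices `ρ_P, ρ_N`, the quantum Bhattacharyya coefficient is `0` iff the two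
states can be distinguished with certainty (disjoint supports, equivalently
`ρ_P · ρ_N = 0`), and `1` iff the two states coincide. -/
theorem qBhattacharyya_eq_zero_iff_and_eq_one_iff
    (n : ℕ) (ρP ρN : Matrix (Fin n) (Fin n) ℂ)
    (hP : ρP.PosSemidef) (hP1 : ρP.trace = 1)
    (hN : ρN.PosSemidef) (hN1 : ρN.trace = 1) :
    (qBhattacharyya n ρP ρN = 0 ↔ ρP * ρN = 0) ∧
      (qBhattacharyya n ρP ρN = 1 ↔ ρP = ρN) := by
  have hmono := upper_mono (N := ρN) hP hP1 hN1
  have hconc := upper_concave (N := ρN) hP hP1 hN1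
  have hone := upper_one (N := ρN) hP hP1 hN1
  refine ⟨⟨fun hB => ?_, fun h => ?_⟩, ⟨fun hB => ?_, fun h => ?_⟩⟩
  · apply aux_tr_zero hP hN
    refine le_antisymm ?_ (aux_tr_nonneg hP hN)
    apply le_of_forall_pos_le_add
    intro ε hε
    obtain ⟨t, ht0, ht1, ht⟩ := an_zero hmono hconc hone hB (ε := min 1 (ε / 4))
      (lt_min one_pos (by linarith)) (min_le_left _ _)
    have ht2 : t < ε / 4 := lt_of_lt_of_le ht1 (min_le_right _ _)
    have ht3 : t < 1 := lt_of_lt_of_le ht1 (min_le_left _ _)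
    obtain ⟨y, ⟨M, hM, hK, e⟩, hy⟩ := upper_approx (P := ρP) (N := ρN) hP1 hN1 ⟨ht0.le, ht3.le⟩
      (ε := ε / 4) (by linarith)
    rw [Prod.mk.injEq] at e
    have hb := aux_bound hM hK hP (aux_one_sub hP hP1) hN (aux_one_sub hN hN1)
    rw [Matrix.sub_mul, Matrix.one_mul, Matrix.trace_sub, Complex.sub_re, hP1, Complex.one_re,
      ← e.1, ← e.2] at hb
    linarith
  · obtain ⟨M, G, hM, hK, hMP, hG⟩ := aux_proj hP
    have hMN : M * ρN = 0 := by rw [hG, Matrix.mul_assoc, h, Matrix.mul_zero]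
    have h01 : ((0:ℝ), (1:ℝ)) ∈ ROCregion n ρN ρP :=
      ⟨M, hM, hK, by rw [hMN, hMP, hP1]; simp⟩
    rw [qB_of_eqOn (g := fun _ => (1:ℝ)) (c := 0), Real.sqrt_zero]
    · intro x hx
      have hx' := Set.Ioo_subset_Icc_self hx
      refine le_antisymm (upper_le_one hP hP1 hN1 hx') ?_
      have := le_upper hP hP1 h01
      exact this.trans (hmono (by simp) hx' hx'.1)
    · intro x; simp
  · have hle : ∀ M : Matrix (Fin n) (Fin n) ℂ, M.PosSemidef → (1 - M).PosSemidef →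
        (M * ρP).trace.re ≤ (M * ρN).trace.re := by
      intro M hM hK
      have h0 : 0 ≤ rocUpper n ρN ρP 0 := le_upper hP hP1 roc_zero
      have hx : (M * ρN).trace.re ∈ Set.Icc (0:ℝ) 1 :=
        ⟨aux_tr_nonneg hM hN, roc_le_one hK hN hN1⟩
      exact (le_upper hP hP1 ⟨M, hM, hK, rfl⟩).trans (an_one hmono hconc hone h0 hB hx)
    have e1 := hle ρP hP (aux_one_sub hP hP1)
    have e2 := hle (1 - ρN) (aux_one_sub hN hN1) (by rwa [sub_sub_cancel])
    simp only [Matrix.sub_mul, Matrix.one_mul, Matrix.trace_sub, Complex.sub_re, hP1, hN1] at e2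
    have hH : (ρP - ρN)ᴴ = ρP - ρN := (hP.1.sub hN.1).eq
    have hpsd := Matrix.posSemidef_conjTranspose_mul_self (ρP - ρN)
    have hz := aux_tr_zero (A := (ρP - ρN)ᴴ * (ρP - ρN)) hpsd Matrix.PosSemidef.one (by
      refine le_antisymm ?_ (aux_tr_nonneg hpsd Matrix.PosSemidef.one)
      rw [hH, Matrix.mul_one]
      simp only [Matrix.sub_mul, Matrix.mul_sub, Matrix.trace_sub, Complex.sub_re]
      linarith)
    rw [Matrix.mul_one, Matrix.conjTranspose_mul_self_eq_zero] at hz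
    exact sub_eq_zero.1 hz
  · subst h
    rw [qB_of_eqOn (g := fun x => x) (c := 1), Real.sqrt_one]
    · intro x hx
      have hx' := Set.Ioo_subset_Icc_self hx
      refine le_antisymm ?_ (le_upper hP hP1 (roc_diag hP1 hP1 hx'))
      apply csSup_le ⟨x, roc_diag hP1 hP1 hx'⟩
      rintro y ⟨M, hM, hK, e⟩
      rw [Prod.mk.injEq] at e
      rw [e.1, e.2]
    · intro x; simp
end

section
/- Let ρ_P and ρ_N be n×n complex density matrices. The quantum Bhattacharyya coefficient is bounded above by the square-root fidelity: B(ρ_P, ρ_N) ≤ tr √(√ρ_N · ρ_P · √ρ_N), with equality if and only if ρ_P and ρ_N commute (ρ_P ρ_N = ρ_N ρ_P). -/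
open scoped ComplexOrder Matrix

namespace QB

theorem spec {n : ℕ} {A : Matrix (Fin n) (Fin n) ℂ} (hA : A.IsHermitian) :
    ∃ (U : Matrix (Fin n) (Fin n) ℂ) (d : Fin n → ℝ), Uᴴ * U = 1 ∧ U * Uᴴ = 1 ∧
      A = U * Matrix.diagonal (fun i => (d i : ℂ)) * Uᴴ := by
  refine ⟨hA.eigenvectorUnitary, hA.eigenvalues, ?_, ?_, ?_⟩
  · exact Unitary.coe_star_mul_self _
  · exact Unitary.coe_mul_star_self _
  · have := hA.spectral_theorem
    rw [Unitary.conjStarAlgAut_apply] at this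
    exact this

theorem psd_factor {n : ℕ} {A : Matrix (Fin n) (Fin n) ℂ} (hA : A.PosSemidef) :
    ∃ C : Matrix (Fin n) (Fin n) ℂ, A = Cᴴ * C := by
  obtain ⟨U, d, h1, h2, h3⟩ := spec hA.1
  have hd : ∀ i, 0 ≤ d i := by
    intro i
    have h4 : Uᴴ * A * U = Matrix.diagonal (fun i => (d i : ℂ)) := by
      rw [h3]
      calc _ = (Uᴴ * U) * Matrix.diagonal (fun i => (d i : ℂ)) * (Uᴴ * U) := by
            simp only [Matrix.mul_assoc]
        _ = _ := by rw [h1]; simp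
    have h5 := (hA.conjTranspose_mul_mul_same U).diag_nonneg (i := i)
    rw [h4] at h5
    simpa using h5
  refine ⟨Matrix.diagonal (fun i => ((Real.sqrt (d i) : ℝ) : ℂ)) * Uᴴ, ?_⟩
  rw [Matrix.conjTranspose_mul, Matrix.diagonal_conjTranspose, Matrix.conjTranspose_conjTranspose]
  conv_lhs => rw [h3]
  have : Matrix.diagonal (fun i => (d i : ℂ)) =
    Matrix.diagonal (star fun i => ((Real.sqrt (d i) : ℝ) : ℂ)) *
      Matrix.diagonal (fun i => ((Real.sqrt (d i) : ℝ) : ℂ)) := by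
    rw [Matrix.diagonal_mul_diagonal]
    congr 1
    ext i
    simp only [Pi.star_apply, Complex.star_def, Complex.conj_ofReal]
    rw [← Complex.ofReal_mul, Real.mul_self_sqrt (hd i)]
  rw [this]
  simp only [Matrix.mul_assoc]

theorem trace_mul_re_nonneg {n : ℕ} {A B : Matrix (Fin n) (Fin n) ℂ} (hA : A.PosSemidef)
    (hB : B.PosSemidef) : 0 ≤ (A * B).trace.re := by
  obtain ⟨C, rfl⟩ := psd_factor hB
  rw [← Matrix.mul_assoc, Matrix.trace_mul_comm, ← Matrix.mul_assoc]
  exact (Complex.le_def.1 (hA.mul_mul_conjTranspose_same C).trace_nonneg).1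

theorem psd_row_zero {n : ℕ} {A : Matrix (Fin n) (Fin n) ℂ} (hA : A.PosSemidef) {i : Fin n}
    (h : (A i i).re = 0) (j : Fin n) : A i j = 0 ∧ A j i = 0 := by
  obtain ⟨C, rfl⟩ := psd_factor hA
  have hC : ∀ k, C k i = 0 := by
    rw [Matrix.mul_apply, Complex.re_sum] at h
    have h2 : ∀ k, ((Cᴴ i k) * (C k i)).re = Complex.normSq (C k i) := by
      intro k
      simp [Matrix.conjTranspose_apply, Complex.normSq_apply]
    simp only [h2] at h
    rw [Finset.sum_eq_zero_iff_of_nonneg (fun k _ => Complex.normSq_nonneg _)] at h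
    intro k
    exact Complex.normSq_eq_zero.1 (h k (Finset.mem_univ _))
  constructor <;> simp [Matrix.mul_apply, hC]

theorem diag_re_nonneg {n : ℕ} {A : Matrix (Fin n) (Fin n) ℂ} (hA : A.PosSemidef) (i : Fin n) :
    0 ≤ (A i i).re := (Complex.le_def.1 (hA.diag_nonneg (i := i))).1

theorem proj_psd {n : ℕ} {M : Matrix (Fin n) (Fin n) ℂ} (h1 : Mᴴ = M) (h2 : M * M = M) :
    M.PosSemidef ∧ (1 - M).PosSemidef := by
  constructor
  · have := Matrix.posSemidef_conjTranspose_mul_self M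
    rwa [h1, h2] at this
  · have := Matrix.posSemidef_conjTranspose_mul_self (1 - M)
    have h3 : (1 - M)ᴴ * (1 - M) = 1 - M := by
      rw [Matrix.conjTranspose_sub, h1, Matrix.conjTranspose_one]
      simp [sub_mul, mul_sub, h2]
    rwa [h3] at this

def HH {n : ℕ} (P N : Matrix (Fin n) (Fin n) ℂ) : Prop :=
  ∀ t : ℝ, 0 < t → ∀ M : Matrix (Fin n) (Fin n) ℂ, M.PosSemidef → (1 - M).PosSemidef →
    (M * P).trace.re - t * (M * N).trace.re ≤ ∑ i, max ((P i i).re - t * (N i i).re) 0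

theorem key_entry {n : ℕ} {A : Matrix (Fin n) (Fin n) ℂ} (hA : A.IsHermitian)
    (H : ∀ M : Matrix (Fin n) (Fin n) ℂ, M.PosSemidef → (1 - M).PosSemidef →
      (M * A).trace.re ≤ ∑ i, max ((A i i).re) 0) {i j : Fin n} (hi : A i i = 0) (hij : i ≠ j) :
    A i j = 0 := by
  classical
  by_contra hz
  set z := A i j with hzdef
  have hzz : 0 < Complex.normSq z := Complex.normSq_pos.2 hz
  have hji : A j i = star z := by rw [hzdef, hA.apply]
  -- main inequality
  have main : ∀ s : ℝ, 2 * s * Complex.normSq z + (A j j).re ≤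
      max ((A j j).re) 0 * (s ^ 2 * Complex.normSq z + 1) := by
    intro s
    set c : ℝ := s ^ 2 * Complex.normSq z + 1 with hc
    have hcpos : 0 < c := by positivity
    have hcne : (c : ℂ) ≠ 0 := by exact_mod_cast hcpos.ne'
    let v : Fin n → ℂ := fun k => if k = i then s * z else if k = j then 1 else 0
    let D : Matrix (Fin n) (Fin n) ℂ :=
      Matrix.diagonal (fun k => if k ≠ i ∧ k ≠ j ∧ 0 < (A k k).re then 1 else 0)
    let V : Matrix (Fin n) (Fin n) ℂ := Matrix.vecMulVec v (star v)
    have hvv : star v ⬝ᵥ v = c := by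
      have h0 : ∀ k, star v k * v k = (if k = i then ((s ^ 2 * Complex.normSq z : ℝ) : ℂ) else 0)
          + (if k = j then 1 else 0) := by
        intro k
        simp only [v, Pi.star_apply]
        by_cases h1 : k = i
        · have : k ≠ j := fun h => hij (h1 ▸ h)
          simp [h1, hij]
          rw [← Complex.mul_conj]; ring
        · by_cases h2 : k = j
          · simp [h2, hij.symm]
          · simp [h1, h2]
      simp only [dotProduct, h0, Finset.sum_add_distrib]
      simp [hc]
    have hDV : D * V = 0 := by
      ext a b
      simp only [D, V, Matrix.diagonal_mul, Matrix.vecMulVec_apply, v, Matrix.zero_apply]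
      by_cases h1 : a = i <;> by_cases h2 : a = j <;> simp [h1, h2]
    have hVD : V * D = 0 := by
      ext a b
      simp only [D, V, Matrix.mul_diagonal, Matrix.vecMulVec_apply, v, Matrix.zero_apply,
        Pi.star_apply]
      by_cases h1 : b = i <;> by_cases h2 : b = j <;> simp [h1, h2]
    have hVV : V * V = (c : ℂ) • V := by
      simp only [V]
      rw [Matrix.vecMulVec_mul_vecMulVec, hvv]
      ext a b
      simp [Matrix.vecMulVec_apply]; ring
    have hDD : D * D = D := by
      simp only [D, Matrix.diagonal_mul_diagonal]
      congr 1; ext k; split_ifs <;> simp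
    have hVh : Vᴴ = V := by
      ext a b
      simp [V, Matrix.conjTranspose_apply, Matrix.vecMulVec_apply]; ring
    have hDh : Dᴴ = D := by
      simp only [D, Matrix.diagonal_conjTranspose]
      congr 1; ext k; simp only [Pi.star_apply]; split_ifs <;> simp
    obtain ⟨m1, m2⟩ := proj_psd (M := D + (c : ℂ)⁻¹ • V)
      (by rw [Matrix.conjTranspose_add, Matrix.conjTranspose_smul, hVh, hDh]
          congr 2; simp)
      (by simp only [add_mul, mul_add, Matrix.smul_mul, Matrix.mul_smul, hDV, hVD, hVV, hDD]
          rw [smul_smul, smul_smul, mul_assoc, inv_mul_cancel₀ hcne, mul_one]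
          simp)
    have h := H _ m1 m2
    have htr : ((D + (c : ℂ)⁻¹ • V) * A).trace.re =
      (∑ k, if k ≠ i ∧ k ≠ j ∧ 0 < (A k k).re then (A k k).re else 0) +
        c⁻¹ * (2 * s * Complex.normSq z + (A j j).re) := by
      rw [add_mul, Matrix.trace_add, Complex.add_re]
      congr 1
      · simp only [Matrix.trace, Matrix.diag, D, Matrix.diagonal_mul, Complex.re_sum]
        refine Finset.sum_congr rfl fun k _ => ?_
        split_ifs <;> simp
      · rw [Matrix.smul_mul, Matrix.trace_smul]
        have : (V * A).trace = ((2 * s * Complex.normSq z : ℝ) : ℂ) + A j j := by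
          simp only [V]
          rw [Matrix.vecMulVec_mul, Matrix.trace_vecMulVec]
          have h1 : ∀ k, v k = (if k = i then s * z else 0) + (if k = j then 1 else 0) := by
            intro k
            simp only [v]
            by_cases h1 : k = i
            · simp [h1, hij]
            · simp [h1]
          have h2 : ∀ k, (star v ᵥ* A) k = s * star z * A i k + A j k := by
            intro k
            simp only [Matrix.vecMul, dotProduct, Pi.star_apply, h1]
            simp [add_mul, Finset.sum_add_distrib, apply_ite (starRingEnd ℂ)]
          simp only [dotProduct, h2, h1]
          simp only [add_mul, Finset.sum_add_distrib, ite_mul, zero_mul, Finset.sum_ite_eq',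
            Finset.mem_univ, if_true, one_mul]
          rw [hi, hji, ← hzdef]
          push_cast
          rw [← Complex.mul_conj]
          simp only [Complex.star_def]
          ring
        rw [this, smul_eq_mul, ← Complex.ofReal_inv, Complex.re_ofReal_mul, Complex.add_re,
          Complex.ofReal_re]
    have hsum : ∑ k, max ((A k k).re) 0 =
       (∑ k, if k ≠ i ∧ k ≠ j ∧ 0 < (A k k).re then (A k k).re else 0) + max ((A j j).re) 0 := by
      have : ∀ k, max ((A k k).re) 0 = (if k ≠ i ∧ k ≠ j ∧ 0 < (A k k).re then (A k k).re else 0)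
         + (if k = j then max ((A j j).re) 0 else 0) := by
        intro k
        by_cases h1 : k = i
        · subst h1; simp [hi, hij]
        · by_cases h2 : k = j
          · simp [h2]
          · by_cases h3 : 0 < (A k k).re
            · simp [h1, h2, h3, h3.le]
            · simp [h1, h2, h3, not_lt.1 h3]
      rw [Finset.sum_congr rfl fun k _ => this k, Finset.sum_add_distrib]
      congr 1
      rw [Finset.sum_ite_eq' Finset.univ j]
      simp only [Finset.mem_univ, if_true]
    rw [htr, hsum] at h
    have h' : c⁻¹ * (2 * s * Complex.normSq z + (A j j).re) ≤ max ((A j j).re) 0 := by linarith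
    rw [inv_mul_le_iff₀ hcpos] at h'
    linarith
  rcases le_or_gt (A j j).re 0 with hj | hj
  · rw [max_eq_right hj] at main
    have := main ((1 - (A j j).re) / (2 * Complex.normSq z))
    have e : 2 * ((1 - (A j j).re) / (2 * Complex.normSq z)) * Complex.normSq z
      = 1 - (A j j).re := by field_simp
    rw [e] at this
    linarith
  · rw [max_eq_left hj.le] at main
    have := main (1 / (A j j).re)
    have e : (A j j).re * ((1 / (A j j).re) ^ 2 * Complex.normSq z + 1)
      = (1 / (A j j).re) * Complex.normSq z + (A j j).re := by field_simp
    rw [e] at this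
    have : 0 < (1 / (A j j).re) * Complex.normSq z := by positivity
    linarith

theorem commute_of_HH {n : ℕ} {P N : Matrix (Fin n) (Fin n) ℂ} (hP : P.PosSemidef)
    (hN : N.PosSemidef) (H : HH P N) : P * N = N * P := by
  have rP : ∀ i, ((P i i).re : ℂ) = P i i := fun i => hP.1.coe_re_apply_self i
  have rN : ∀ i, ((N i i).re : ℂ) = N i i := fun i => hN.1.coe_re_apply_self i
  have key : ∀ i j, N i i * P i j = P i i * N i j := by
    intro i j
    rcases (diag_re_nonneg hP i).eq_or_lt with hp | hp
    · rw [(psd_row_zero hP hp.symm j).1, (psd_row_zero hP hp.symm i).1]; simp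
    rcases (diag_re_nonneg hN i).eq_or_lt with hq | hq
    · rw [(psd_row_zero hN hq.symm j).1, (psd_row_zero hN hq.symm i).1]; simp
    by_cases hij : i = j
    · subst hij; ring
    set t : ℝ := (P i i).re / (N i i).re with ht
    have htpos : 0 < t := by positivity
    have hh : (P - (t : ℂ) • N).IsHermitian := by
      refine hP.1.sub ?_
      unfold Matrix.IsHermitian
      rw [Matrix.conjTranspose_smul, hN.1]; simp
    have htn : (t : ℂ) * N i i = P i i := by
      rw [← rN, ← rP, ← Complex.ofReal_mul, ht, div_mul_cancel₀ _ hq.ne']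
    have := key_entry hh (i := i) (j := j) ?_ (by simp [htn]) hij
    · have h2 : P i j = t * N i j := by
        simpa [sub_eq_zero] using this
      rw [h2, ← htn]; ring
    · intro M m1 m2
      have := H t htpos M m1 m2
      simpa [mul_sub, Matrix.trace_sub] using this
  have key2 : ∀ i j, N j j * P i j = P j j * N i j := by
    intro i j
    have := congrArg star (key j i)
    rwa [star_mul', star_mul', hP.1.apply, hP.1.apply, hN.1.apply, hN.1.apply] at this
  ext i j
  rw [Matrix.mul_apply, Matrix.mul_apply]
  refine Finset.sum_congr rfl fun k _ => ?_
  by_cases hq : N k k = 0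
  · have : (N k k).re = 0 := by simp [hq]
    rw [(psd_row_zero hN this j).1, (psd_row_zero hN this i).2]; simp
  · apply mul_left_cancel₀ hq
    have h1 := key2 i k
    have h2 := key k j
    calc N k k * (P i k * N k j) = (N k k * P i k) * N k j := by ring
      _ = N i k * (P k k * N k j) := by rw [h1]; ring
      _ = _ := by rw [← h2]; ring

end QB
namespace QB

theorem sandwich_mul {n : ℕ} {U A B : Matrix (Fin n) (Fin n) ℂ} (h : U * Uᴴ = 1) :
    (Uᴴ * A * U) * (Uᴴ * B * U) = Uᴴ * (A * B) * U := by
  calc _ = Uᴴ * A * (U * Uᴴ) * B * U := by simp only [Matrix.mul_assoc]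
    _ = _ := by rw [h]; simp only [Matrix.mul_assoc, Matrix.mul_one]

theorem sandwich_trace {n : ℕ} {U A : Matrix (Fin n) (Fin n) ℂ} (h : U * Uᴴ = 1) :
    (Uᴴ * A * U).trace = A.trace := by
  rw [Matrix.trace_mul_comm, ← Matrix.mul_assoc, h, Matrix.one_mul]

theorem pinv {n : ℕ} {A : Matrix (Fin n) (Fin n) ℂ} (hA : A.IsHermitian) :
    ∃ Y : Matrix (Fin n) (Fin n) ℂ, Yᴴ = Y ∧ A * Y = Y * A ∧ A * Y * A = A ∧ Y * A * Y = Y := by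
  obtain ⟨U, d, h1, h2, h3⟩ := spec hA
  have hm : ∀ D E : Matrix (Fin n) (Fin n) ℂ, (U * D * Uᴴ) * (U * E * Uᴴ) = U * (D * E) * Uᴴ := by
    intro D E
    have := sandwich_mul (U := Uᴴ) (A := D) (B := E) (by simpa using h1)
    simpa using this
  refine ⟨U * Matrix.diagonal (fun i => ((d i)⁻¹ : ℂ)) * Uᴴ, ?_, ?_, ?_, ?_⟩
  · rw [Matrix.conjTranspose_mul, Matrix.conjTranspose_mul, Matrix.conjTranspose_conjTranspose,
      Matrix.diagonal_conjTranspose, Matrix.mul_assoc]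
    congr 3
    ext i; simp
  · rw [h3, hm, hm, Matrix.diagonal_mul_diagonal, Matrix.diagonal_mul_diagonal]
    congr 3; ext i; rw [mul_comm]
  · rw [h3, hm, hm, Matrix.diagonal_mul_diagonal, Matrix.diagonal_mul_diagonal]
    congr 3; ext i; by_cases h : (d i : ℂ) = 0 <;> simp [h]
  · rw [h3, hm, hm, Matrix.diagonal_mul_diagonal, Matrix.diagonal_mul_diagonal]
    congr 3; ext i; by_cases h : (d i : ℂ) = 0 <;> simp [h]

theorem pinv_comm {n : ℕ} {A Y C : Matrix (Fin n) (Fin n) ℂ} (h1 : A * Y = Y * A)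
    (h2 : A * Y * A = A) (h3 : Y * A * Y = Y) (hC : C * A = A * C) :
    C * (A * Y) = (A * Y) * C ∧ C * Y = Y * C := by
  have e1 : (A * Y) * C * A = C * A := by
    calc (A * Y) * C * A = A * Y * (C * A) := by simp only [mul_assoc]
      _ = (A * Y * A) * C := by rw [hC]; simp only [mul_assoc]
      _ = C * A := by rw [h2, hC]
  have e2 : A * C * (A * Y) = A * C := by
    calc A * C * (A * Y) = (A * C) * (Y * A) := by rw [h1]
      _ = (C * A) * (Y * A) := by rw [hC]
      _ = C * (A * Y * A) := by simp only [mul_assoc]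
      _ = A * C := by rw [h2, hC]
  have f1 : (A * Y) * C * (A * Y) = C * (A * Y) := by
    rw [← mul_assoc, e1, mul_assoc]
  have f2 : (A * Y) * C * (A * Y) = (A * Y) * C := by
    calc (A * Y) * C * (A * Y) = Y * (A * C * (A * Y)) := by rw [h1]; simp only [mul_assoc]
      _ = _ := by rw [e2, h1, mul_assoc]
  have g : C * (A * Y) = (A * Y) * C := by rw [← f1, f2]
  refine ⟨g, ?_⟩
  calc C * Y = C * (A * Y) * Y := by
        conv_lhs => rw [← h3]
        rw [← h1]; simp only [mul_assoc]
    _ = (A * Y) * C * Y := by rw [g]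
    _ = Y * (A * C) * Y := by rw [h1]; simp only [mul_assoc]
    _ = Y * (C * (A * Y)) := by rw [← hC]; simp only [mul_assoc]
    _ = Y * (A * Y * C) := by rw [g]
    _ = Y * A * Y * C := by simp only [mul_assoc]
    _ = Y * C := by rw [h3]

theorem sqrt_comm {n : ℕ} {F C : Matrix (Fin n) (Fin n) ℂ} (hF : F.PosSemidef)
    (h : C * (F * F) = (F * F) * C) : C * F = F * C := by
  obtain ⟨U, d, h1, h2, h3⟩ := spec hF.1
  have hD : Uᴴ * F * U = Matrix.diagonal (fun i => (d i : ℂ)) := by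
    rw [h3]
    calc _ = (Uᴴ * U) * Matrix.diagonal (fun i => (d i : ℂ)) * (Uᴴ * U) := by
          simp only [Matrix.mul_assoc]
      _ = _ := by rw [h1]; simp
  have hd : ∀ i, 0 ≤ d i := by
    intro i
    have h5 := (hF.conjTranspose_mul_mul_same U).diag_nonneg (i := i)
    rw [hD] at h5
    simpa using h5
  have h' : (Uᴴ * C * U) * ((Uᴴ * F * U) * (Uᴴ * F * U)) =
    ((Uᴴ * F * U) * (Uᴴ * F * U)) * (Uᴴ * C * U) := by
    rw [sandwich_mul h2, sandwich_mul h2, sandwich_mul h2, h]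
  have h'' : (Uᴴ * C * U) * (Uᴴ * F * U) = (Uᴴ * F * U) * (Uᴴ * C * U) := by
    rw [hD] at h' ⊢
    rw [Matrix.diagonal_mul_diagonal] at h'
    ext i j
    have hij := congrFun (congrFun h' i) j
    rw [Matrix.mul_diagonal, Matrix.diagonal_mul] at hij ⊢
    by_cases hc : (Uᴴ * C * U) i j = 0
    · simp [hc]
    · have : (d j : ℂ) * d j = d i * d i := by
        apply mul_left_cancel₀ hc
        rw [hij]; ring
      have h6 : d j * d j = d i * d i := by exact_mod_cast this
      have : d j = d i := by
        have := mul_self_inj (hd j) (hd i)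
        exact this.1 h6
      rw [this]; ring
  rw [sandwich_mul h2, sandwich_mul h2] at h''
  have := congrArg (fun Z => U * Z * Uᴴ) h''
  have hu : ∀ Z, U * (Uᴴ * Z * U) * Uᴴ = Z := by
    intro Z
    calc _ = (U * Uᴴ) * Z * (U * Uᴴ) := by simp only [Matrix.mul_assoc]
      _ = Z := by rw [h2]; simp
  simpa only [hu] using this

theorem simdiag {n : ℕ} {X E : Matrix (Fin n) (Fin n) ℂ} (hX : X.PosSemidef) (hE : Eᴴ = E)
    (hEE : E * E = E) (hEX : E * X = X) :
    ∃ (U : Matrix (Fin n) (Fin n) ℂ) (d e : Fin n → ℝ), Uᴴ * U = 1 ∧ U * Uᴴ = 1 ∧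
      Uᴴ * X * U = Matrix.diagonal (fun i => (d i : ℂ)) ∧
      Uᴴ * E * U = Matrix.diagonal (fun i => (e i : ℂ)) ∧
      (∀ i, 0 ≤ d i) ∧ (∀ i, e i = 0 ∧ d i = 0 ∨ e i = 1) := by
  classical
  have hH : (X - (1 - E)).IsHermitian := by
    unfold Matrix.IsHermitian
    simp [hE, hX.1.eq]
  obtain ⟨U, x, h1, h2, h3⟩ := spec hH
  have hD : Uᴴ * (X - (1 - E)) * U = Matrix.diagonal (fun i => (x i : ℂ)) := by
    rw [h3]
    calc _ = (Uᴴ * U) * Matrix.diagonal (fun i => (x i : ℂ)) * (Uᴴ * U) := by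
          simp only [Matrix.mul_assoc]
      _ = _ := by rw [h1]; simp
  have hX' := hX.conjTranspose_mul_mul_same U
  have hE' : (Uᴴ * E * U).PosSemidef := (proj_psd hE hEE).1.conjTranspose_mul_mul_same U
  have hEE' := sandwich_mul (A := E) (B := E) h2
  have hEX' := sandwich_mul (A := E) (B := X) h2
  rw [hEE] at hEE'
  rw [hEX] at hEX'
  rw [mul_sub, sub_mul, mul_sub, sub_mul, Matrix.mul_one, h1] at hD
  obtain ⟨X', hX0⟩ : ∃ X', Uᴴ * X * U = X' := ⟨_, rfl⟩
  obtain ⟨E', hE0⟩ : ∃ E', Uᴴ * E * U = E' := ⟨_, rfl⟩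
  rw [hX0] at hX' hEX' hD
  rw [hE0] at hE' hEE' hEX' hD
  have a1 : E' * Matrix.diagonal (fun i => (x i : ℂ)) = X' := by
    rw [← hD, mul_sub, mul_sub, hEX', hEE']; simp
  have a2 : X' = Matrix.diagonal (fun i => (x i : ℂ)) + (1 - E') := by rw [← hD]; abel
  have b1 : ∀ i j, E' i j * x j = X' i j := by
    intro i j
    rw [← a1, Matrix.mul_diagonal]
  have b2 : ∀ i j, X' i j = (if i = j then (x i : ℂ) else 0) + ((if i = j then 1 else 0) - E' i j) := by
    intro i j
    conv_lhs => rw [a2]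
    simp [Matrix.diagonal_apply, Matrix.one_apply]
  have c1 : ∀ i j, 0 ≤ x j → E' i j = if i = j then 1 else 0 := by
    intro i j hj
    have h := b2 i j
    rw [← b1] at h
    have hx : (1 + x j : ℂ) ≠ 0 := by
      have : (1 + x j) ≠ 0 := by positivity
      exact_mod_cast this
    apply mul_right_cancel₀ hx
    by_cases hij : i = j
    · subst hij; simp at h ⊢; linear_combination h
    · simp [hij] at h ⊢
      have : E' i j * (1 + x j) = 0 := by linear_combination h
      simpa [hx] using this
  have c2 : ∀ i j, x j < 0 → E' i j = 0 := by
    intro i j hj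
    have p1 := diag_re_nonneg hX' j
    have p2 := diag_re_nonneg hE' j
    rw [← b1, Complex.re_mul_ofReal] at p1
    have : (E' j j).re = 0 := by nlinarith
    exact (psd_row_zero hE' this i).2
  refine ⟨U, fun i => max (x i) 0, fun i => if 0 ≤ x i then 1 else 0, h1, h2, ?_, ?_, ?_, ?_⟩
  · rw [hX0]
    ext i j
    rw [← b1, Matrix.diagonal_apply]
    rcases le_or_gt 0 (x j) with hj | hj
    · rw [c1 i j hj]
      by_cases hij : i = j
      · subst hij; simp [hj]
      · simp [hij]
    · rw [c2 i j hj]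
      by_cases hij : i = j
      · subst hij; simp [hj.le]
      · simp [hij]
  · rw [hE0]
    ext i j
    rw [Matrix.diagonal_apply]
    rcases le_or_gt 0 (x j) with hj | hj
    · rw [c1 i j hj]
      by_cases hij : i = j
      · subst hij; simp [hj]
      · simp [hij]
    · rw [c2 i j hj]
      by_cases hij : i = j
      · subst hij; simp [not_le.2 hj]
      · simp [hij]
  · intro i; exact le_max_right _ _
  · intro i
    rcases le_or_gt 0 (x i) with hj | hj
    · right; simp [hj]
    · left; simp [hj, hj.le]

theorem good_basis {n : ℕ} {P N s : Matrix (Fin n) (Fin n) ℂ} {d e : Fin n → ℝ}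
    (hP : P.PosSemidef) (hN : N.PosSemidef) (hs : s.PosSemidef) (hss : s * s = N)
    (hd : ∀ i, 0 ≤ d i) (he : ∀ i, e i = 0 ∧ d i = 0 ∨ e i = 1)
    (hPX : Matrix.diagonal (fun i => (e i : ℂ)) * P * Matrix.diagonal (fun i => (e i : ℂ)) =
      Matrix.diagonal (fun i => (d i : ℂ)) * N * Matrix.diagonal (fun i => (d i : ℂ)))
    (hEN : Matrix.diagonal (fun i => (e i : ℂ)) * N = N) :
    (∑ i, Real.sqrt ((P i i).re * (N i i).re) =
      (N * Matrix.diagonal (fun i => (d i : ℂ))).trace.re) ∧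
    (P * Matrix.diagonal (fun i => (e i : ℂ)) = Matrix.diagonal (fun i => (e i : ℂ)) * P →
      s * Matrix.diagonal (fun i => (d i : ℂ)) = Matrix.diagonal (fun i => (d i : ℂ)) * s →
      HH P N) := by
  have rP : ∀ i, ((P i i).re : ℂ) = P i i := fun i => hP.1.coe_re_apply_self i
  have rN : ∀ i, ((N i i).re : ℂ) = N i i := fun i => hN.1.coe_re_apply_self i
  have hp : ∀ i, e i = 1 → (P i i).re = d i ^ 2 * (N i i).re := by
    intro i hi
    have := congrFun (congrFun hPX i) i
    rw [Matrix.mul_diagonal, Matrix.diagonal_mul, Matrix.mul_diagonal, Matrix.diagonal_mul, hi,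
      ← rP, ← rN] at this
    have h2 : (1 : ℝ) * (P i i).re * 1 = d i * (N i i).re * d i := by exact_mod_cast this
    linarith
  have hq : ∀ i, e i = 0 → (N i i).re = 0 := by
    intro i hi
    have := congrFun (congrFun hEN i) i
    rw [Matrix.diagonal_mul, hi] at this
    rw [← this]; simp
  constructor
  · simp only [Matrix.trace, Matrix.diag, Complex.re_sum, Matrix.mul_diagonal]
    refine Finset.sum_congr rfl fun i _ => ?_
    rw [Complex.re_mul_ofReal]
    rcases he i with ⟨h, -⟩ | h
    · simp [hq i h]
    · rw [hp i h]
      have : d i ^ 2 * (N i i).re * (N i i).re = ((N i i).re * d i) ^ 2 := by ring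
      rw [this, Real.sqrt_sq (mul_nonneg (diag_re_nonneg hN i) (hd i))]
  · intro c1 c2 t ht M m1 m2
    set E := Matrix.diagonal (fun i => (e i : ℂ)) with hE
    set D := Matrix.diagonal (fun i => (d i : ℂ)) with hD
    have hEh : Eᴴ = E := by
      rw [hE, Matrix.diagonal_conjTranspose]; congr 1; ext i; simp
    have hEE : E * E = E := by
      rw [hE, Matrix.diagonal_mul_diagonal]; congr 1; ext i
      rcases he i with ⟨h, -⟩ | h <;> simp [h]
    have hP1 : P = (1 - E)ᴴ * P * (1 - E) + s * (D * D) * s := by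
      have e1 : s * (D * D) * s = E * P * E := by
        rw [hPX, ← hss]
        calc s * (D * D) * s = (s * D) * (D * s) := by simp only [mul_assoc]
          _ = (D * s) * (s * D) := by rw [c2]
          _ = _ := by simp only [mul_assoc]
      rw [e1, Matrix.conjTranspose_sub, hEh, Matrix.conjTranspose_one, mul_assoc E, c1,
        ← mul_assoc E E, hEE, sub_mul, mul_sub, one_mul, mul_one, sub_mul, mul_assoc E,
        c1, ← mul_assoc E E, hEE]
      abel
    have q1 : (M * ((1 - E)ᴴ * P * (1 - E))).trace.re ≤ ∑ i, (1 - e i) * (P i i).re := by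
      have h := trace_mul_re_nonneg m2 (hP.conjTranspose_mul_mul_same (1 - E))
      rw [sub_mul, one_mul, Matrix.trace_sub, Complex.sub_re] at h
      refine (sub_nonneg.1 h).trans (le_of_eq ?_)
      have h1 : (1 - E) = Matrix.diagonal (fun i => ((1 - e i : ℝ) : ℂ)) := by
        rw [hE, ← Matrix.diagonal_one, Matrix.diagonal_sub]; congr 1; ext i; simp
      rw [Matrix.conjTranspose_sub, hEh, Matrix.conjTranspose_one, h1]
      simp only [Matrix.trace, Matrix.diag, Complex.re_sum, Matrix.mul_diagonal,
        Matrix.diagonal_mul]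
      refine Finset.sum_congr rfl fun i _ => ?_
      rw [← rP i]
      norm_cast
      rcases he i with ⟨h, -⟩ | h <;> simp [h]
    have q2 : (M * (s * (D * D) * s)).trace.re - t * (M * N).trace.re =
        ∑ i, ((s * M * s) i i).re * (d i ^ 2 - t) := by
      have e1 : (M * (s * (D * D) * s)).trace = ((s * M * s) * (D * D)).trace := by
        rw [← mul_assoc, Matrix.trace_mul_comm]; simp only [mul_assoc]
      have e2 : (M * N).trace = (s * M * s).trace := by
        rw [← hss, ← mul_assoc, Matrix.trace_mul_comm]; simp only [mul_assoc]
      rw [e1, e2, hD, Matrix.diagonal_mul_diagonal]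
      simp only [Matrix.trace, Matrix.diag, Complex.re_sum, Matrix.mul_diagonal, Finset.mul_sum]
      rw [← Finset.sum_sub_distrib]
      refine Finset.sum_congr rfl fun i _ => ?_
      rw [← Complex.ofReal_mul, Complex.re_mul_ofReal]; ring
    have k1 : ∀ i, 0 ≤ ((s * M * s) i i).re := by
      intro i
      have := m1.conjTranspose_mul_mul_same s
      rw [hs.1] at this
      exact diag_re_nonneg this i
    have k2 : ∀ i, ((s * M * s) i i).re ≤ (N i i).re := by
      intro i
      have := m2.conjTranspose_mul_mul_same s
      rw [hs.1] at this
      have h := diag_re_nonneg this i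
      rw [mul_sub, sub_mul, mul_one, hss] at h
      simpa using h
    have hMP : (M * P).trace.re = (M * ((1 - E)ᴴ * P * (1 - E))).trace.re +
        (M * (s * (D * D) * s)).trace.re := by
      conv_lhs => rw [hP1]
      rw [mul_add, Matrix.trace_add, Complex.add_re]
    calc (M * P).trace.re - t * (M * N).trace.re
        = (M * ((1 - E)ᴴ * P * (1 - E))).trace.re +
          ((M * (s * (D * D) * s)).trace.re - t * (M * N).trace.re) := by rw [hMP]; ring
      _ ≤ ∑ i, (1 - e i) * (P i i).re + ∑ i, ((s * M * s) i i).re * (d i ^ 2 - t) := by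
          rw [q2]; linarith
      _ = ∑ i, ((1 - e i) * (P i i).re + ((s * M * s) i i).re * (d i ^ 2 - t)) := by
          rw [Finset.sum_add_distrib]
      _ ≤ _ := by
          refine Finset.sum_le_sum fun i _ => ?_
          rcases he i with ⟨h, h'⟩ | h
          · have := k1 i
            have h3 := k2 i
            rw [hq i h] at h3
            have : ((s * M * s) i i).re = 0 := le_antisymm h3 this
            rw [this, h, hq i h]; simp
          · rw [h, hp i h]
            rcases le_or_gt (d i ^ 2 - t) 0 with hh | hh
            · refine le_trans ?_ (le_max_right _ _)
              have := mul_nonpos_of_nonneg_of_nonpos (k1 i) hh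
              linarith
            · refine le_trans ?_ (le_max_left _ _)
              have := mul_le_mul_of_nonneg_right (k2 i) hh.le
              linarith

theorem exists_basis {n : ℕ} {P N s F : Matrix (Fin n) (Fin n) ℂ}
    (hP : P.PosSemidef) (hN : N.PosSemidef) (hs : s.PosSemidef) (hss : s * s = N)
    (hF : F.PosSemidef) (hFF : F * F = s * P * s) :
    ∃ U : Matrix (Fin n) (Fin n) ℂ, Uᴴ * U = 1 ∧ U * Uᴴ = 1 ∧
      (∑ i, Real.sqrt (((Uᴴ * P * U) i i).re * ((Uᴴ * N * U) i i).re) = F.trace.re) ∧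
      (P * N = N * P → HH (Uᴴ * P * U) (Uᴴ * N * U)) := by
  obtain ⟨Y, y1, y2, y3, y4⟩ := pinv hs.1
  have hXpsd : (Y * F * Y).PosSemidef := by
    have := hF.conjTranspose_mul_mul_same Y
    rwa [y1] at this
  have hE : (s * Y)ᴴ = s * Y := by
    rw [Matrix.conjTranspose_mul, y1, hs.1.eq, y2]
  have hEE : (s * Y) * (s * Y) = s * Y := by
    rw [← mul_assoc, y3]
  have hEY : (s * Y) * Y = Y := by rw [y2, y4]
  have hYE : Y * (s * Y) = Y := by rw [← mul_assoc, y4]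
  have hEX : (s * Y) * (Y * F * Y) = Y * F * Y := by
    rw [← mul_assoc, ← mul_assoc, hEY]
  have hFE : F * (s * Y) = F := by
    have h0 : (F * (1 - s * Y))ᴴ * (F * (1 - s * Y)) = 0 := by
      have : s * (1 - s * Y) = 0 := by rw [mul_sub, y2, ← mul_assoc, y3]; simp
      rw [Matrix.conjTranspose_mul, hF.1.eq]
      calc _ = (1 - s * Y)ᴴ * (F * F) * (1 - s * Y) := by simp only [mul_assoc]
        _ = (1 - s * Y)ᴴ * (s * P) * (s * (1 - s * Y)) := by rw [hFF]; simp only [mul_assoc]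
        _ = 0 := by rw [this]; simp
    have := Matrix.conjTranspose_mul_self_eq_zero.1 h0
    rw [mul_sub, mul_one, sub_eq_zero] at this
    exact this.symm
  have hEF : (s * Y) * F = F := by
    have := congrArg Matrix.conjTranspose hFE
    rwa [Matrix.conjTranspose_mul, hE, hF.1.eq] at this
  have hXNX : (s * Y) * P * (s * Y) = (Y * F * Y) * N * (Y * F * Y) := by
    rw [← hss]
    calc (s * Y) * P * (s * Y) = Y * (s * P * s) * Y := by
          calc (s * Y) * P * (s * Y) = (Y * s) * P * (s * Y) := by rw [← y2]
            _ = _ := by simp only [mul_assoc]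
      _ = Y * F * (F * Y) := by rw [← hFF]; simp only [mul_assoc]
      _ = Y * (F * (s * Y)) * ((s * Y) * F * Y) := by rw [hFE, hEF]
      _ = Y * F * (Y * s) * ((s * Y) * F * Y) := by rw [← y2]; simp only [mul_assoc]
      _ = _ := by simp only [mul_assoc]
  have htr : (N * (Y * F * Y)).trace = F.trace := by
    rw [← hss]
    calc (s * s * (Y * F * Y)).trace = (s * ((s * Y) * F) * Y).trace := by simp only [mul_assoc]
      _ = (Y * (s * F)).trace := by rw [hEF, Matrix.trace_mul_comm]
      _ = F.trace := by rw [← mul_assoc, ← y2, hEF]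
  have hEN : (s * Y) * N = N := by rw [← hss, ← mul_assoc, y3]
  obtain ⟨U, d, e, u1, u2, hX, hEd, hd, he⟩ := simdiag hXpsd hE hEE hEX
  have G := good_basis (P := Uᴴ * P * U) (N := Uᴴ * N * U) (s := Uᴴ * s * U) (d := d) (e := e)
    (hP.conjTranspose_mul_mul_same U) (hN.conjTranspose_mul_mul_same U)
    (hs.conjTranspose_mul_mul_same U) (by rw [sandwich_mul u2, hss]) hd he
    (by rw [← hX, ← hEd]; simp only [sandwich_mul u2]; rw [hXNX])
    (by rw [← hEd]; simp only [sandwich_mul u2]; rw [hEN])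
  rw [← hX, ← hEd] at G
  simp only [sandwich_mul u2, sandwich_trace u2] at G
  rw [htr] at G
  refine ⟨U, u1, u2, G.1, fun hc => ?_⟩
  have hPs : P * s = s * P := sqrt_comm hs (by rw [hss, hc])
  have hsF : s * F = F * s := sqrt_comm hF (by
    rw [hFF, ← hPs]
    simp only [mul_assoc]
    rw [← mul_assoc s P, ← hPs, mul_assoc])
  obtain ⟨g1, -⟩ := pinv_comm y2 y3 y4 hPs
  refine G.2 (by rw [g1]) ?_
  have : s * (Y * F * Y) = (Y * F * Y) * s := by
    calc _ = (s * Y) * F * Y := by simp only [mul_assoc]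
      _ = Y * (s * F) * Y := by rw [y2]; simp only [mul_assoc]
      _ = Y * F * (s * Y) := by rw [hsF]; simp only [mul_assoc]
      _ = _ := by rw [y2]; simp only [mul_assoc]
  rw [this]

end QB
namespace QB
open MeasureTheory Set

theorem region_bounds {n : ℕ} {P N : Matrix (Fin n) (Fin n) ℂ} (hP : P.PosSemidef)
    (hP1 : P.trace = 1) (hN : N.PosSemidef) (hN1 : N.trace = 1) {x y : ℝ}
    (h : (x, y) ∈ ROCregion n N P) : 0 ≤ x ∧ x ≤ 1 ∧ 0 ≤ y ∧ y ≤ 1 := by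
  obtain ⟨M, m1, m2, he⟩ := h
  obtain ⟨rfl, rfl⟩ := Prod.mk.inj he
  have h1 := trace_mul_re_nonneg m1 hN
  have h2 := trace_mul_re_nonneg m1 hP
  have h3 := trace_mul_re_nonneg m2 hN
  have h4 := trace_mul_re_nonneg m2 hP
  rw [sub_mul, one_mul, Matrix.trace_sub, Complex.sub_re] at h3 h4
  rw [hN1] at h3
  rw [hP1] at h4
  simp at h3 h4
  exact ⟨h1, h3, h2, h4⟩

theorem region_convex {n : ℕ} {P N : Matrix (Fin n) (Fin n) ℂ} {x y x' y' a b : ℝ}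
    (h : (x, y) ∈ ROCregion n N P) (h' : (x', y') ∈ ROCregion n N P)
    (ha : 0 ≤ a) (hb : 0 ≤ b) (hab : a + b = 1) :
    (a * x + b * x', a * y + b * y') ∈ ROCregion n N P := by
  obtain ⟨M, m1, m2, he⟩ := h
  obtain ⟨rfl, rfl⟩ := Prod.mk.inj he
  obtain ⟨M', m1', m2', he'⟩ := h'
  obtain ⟨rfl, rfl⟩ := Prod.mk.inj he'
  have ha' : (0 : ℂ) ≤ (a : ℂ) := by exact_mod_cast ha
  have hb' : (0 : ℂ) ≤ (b : ℂ) := by exact_mod_cast hb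
  have hab' : (a : ℂ) + b = 1 := by exact_mod_cast hab
  refine ⟨(a : ℂ) • M + (b : ℂ) • M', (m1.smul ha').add (m1'.smul hb'), ?_, ?_⟩
  · have : 1 - ((a : ℂ) • M + (b : ℂ) • M') = (a : ℂ) • (1 - M) + (b : ℂ) • (1 - M') := by
      rw [smul_sub, smul_sub]
      have : (1 : Matrix (Fin n) (Fin n) ℂ) = (a : ℂ) • 1 + (b : ℂ) • 1 := by
        rw [← add_smul, hab', one_smul]
      nth_rw 1 [this]
      abel
    rw [this]
    exact (m2.smul ha').add (m2'.smul hb')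
  · simp [add_mul, Matrix.trace_add, Matrix.trace_smul]

theorem region_one {n : ℕ} {P N : Matrix (Fin n) (Fin n) ℂ}
    (hP1 : P.trace = 1) (hN1 : N.trace = 1) : ((1 : ℝ), (1 : ℝ)) ∈ ROCregion n N P :=
  ⟨1, Matrix.PosSemidef.one, by simpa using Matrix.PosSemidef.zero, by simp [hP1, hN1]⟩

theorem region_zero {n : ℕ} {P N : Matrix (Fin n) (Fin n) ℂ} :
    ((0 : ℝ), (0 : ℝ)) ∈ ROCregion n N P :=
  ⟨0, Matrix.PosSemidef.zero, by simpa using Matrix.PosSemidef.one, by simp⟩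

theorem le_upper {n : ℕ} {P N : Matrix (Fin n) (Fin n) ℂ} (hP : P.PosSemidef)
    (hP1 : P.trace = 1) (hN : N.PosSemidef) (hN1 : N.trace = 1) {x y : ℝ}
    (h : (x, y) ∈ ROCregion n N P) : y ≤ rocUpper n N P x :=
  le_csSup ⟨1, fun _ hz => (region_bounds hP hP1 hN hN1 hz).2.2.2⟩ h

theorem upper_le {n : ℕ} {P N : Matrix (Fin n) (Fin n) ℂ}
    (hP1 : P.trace = 1) (hN1 : N.trace = 1) {x c : ℝ} (hx : x ∈ Icc (0 : ℝ) 1)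
    (h : ∀ y, (x, y) ∈ ROCregion n N P → y ≤ c) : rocUpper n N P x ≤ c := by
  refine csSup_le ⟨x, ?_⟩ h
  have := region_convex (region_one hP1 hN1) (region_zero (P := P) (N := N)) hx.1
    (sub_nonneg.2 hx.2) (by ring)
  simpa using this

theorem upper_mono {n : ℕ} {P N : Matrix (Fin n) (Fin n) ℂ} (hP : P.PosSemidef)
    (hP1 : P.trace = 1) (hN : N.PosSemidef) (hN1 : N.trace = 1) :
    MonotoneOn (rocUpper n N P) (Icc 0 1) := by
  intro x hx x' hx' hxx
  refine upper_le hP1 hN1 hx fun y hy => ?_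
  rcases hxx.eq_or_lt with rfl | hlt
  · exact le_upper hP hP1 hN hN1 hy
  have h1x : 0 < 1 - x := by linarith [hx'.2]
  have hs1 : (x' - x) / (1 - x) ≤ 1 := by rw [div_le_one h1x]; linarith [hx'.2]
  have hs0 : 0 ≤ (x' - x) / (1 - x) := div_nonneg (by linarith) h1x.le
  have := region_convex hy (region_one hP1 hN1) (sub_nonneg.2 hs1) hs0 (by ring)
  have e : (1 - (x' - x) / (1 - x)) * x + (x' - x) / (1 - x) * 1 = x' := by
    field_simp; ring
  rw [e] at this
  have h2 := le_upper hP hP1 hN hN1 this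
  have h3 := (region_bounds hP hP1 hN hN1 hy).2.2.2
  nlinarith

theorem upper_concave {n : ℕ} {P N : Matrix (Fin n) (Fin n) ℂ} (hP : P.PosSemidef)
    (hP1 : P.trace = 1) (hN : N.PosSemidef) (hN1 : N.trace = 1) :
    ConcaveOn ℝ (Icc 0 1) (rocUpper n N P) := by
  refine ⟨convex_Icc 0 1, ?_⟩
  intro x hx y hy a b ha hb hab
  simp only [smul_eq_mul]
  set c := rocUpper n N P (a * x + b * y) with hc
  have step : ∀ u, (x, u) ∈ ROCregion n N P → ∀ v, (y, v) ∈ ROCregion n N P →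
      a * u + b * v ≤ c := fun u hu v hv =>
    le_upper hP hP1 hN hN1 (region_convex hu hv ha hb hab)
  have s1 : ∀ u, (x, u) ∈ ROCregion n N P → a * u + b * rocUpper n N P y ≤ c := by
    intro u hu
    rcases hb.eq_or_lt with rfl | hb
    · have hyy : (y, y) ∈ ROCregion n N P := by
        have := region_convex (region_one hP1 hN1) (region_zero (P := P) (N := N)) hy.1
          (sub_nonneg.2 hy.2) (by ring)
        simpa using this
      simpa using step u hu y hyy
    · have : rocUpper n N P y ≤ (c - a * u) / b := by
        refine upper_le hP1 hN1 hy fun v hv => ?_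
        rw [le_div_iff₀ hb]
        linarith [step u hu v hv]
      rw [le_div_iff₀ hb] at this
      linarith
  rcases ha.eq_or_lt with rfl | ha
  · have hxx : (x, x) ∈ ROCregion n N P := by
      have := region_convex (region_one hP1 hN1) (region_zero (P := P) (N := N)) hx.1
        (sub_nonneg.2 hx.2) (by ring)
      simpa using this
    simpa using s1 x hxx
  · have : rocUpper n N P x ≤ (c - b * rocUpper n N P y) / a := by
      refine upper_le hP1 hN1 hx fun v hv => ?_
      rw [le_div_iff₀ ha]
      linarith [s1 v hv]
    rw [le_div_iff₀ ha] at this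
    linarith

theorem lint_min {p q : ℝ} (hp : 0 ≤ p) (hq : 0 ≤ q) :
    ∫⁻ s in Ioi (0 : ℝ), ENNReal.ofReal (min (p / s ^ 2) q) =
      ENNReal.ofReal (2 * Real.sqrt (p * q)) := by
  rcases hp.eq_or_lt with rfl | hp
  · simp [hq]
  rcases hq.eq_or_lt with rfl | hq
  · have : ∀ s : ℝ, min (p / s ^ 2) 0 = 0 := fun s => min_eq_right (by positivity)
    simp [this]
  set c := Real.sqrt p / Real.sqrt q with hc
  have hsp : 0 < Real.sqrt p := Real.sqrt_pos.2 hp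
  have hsq : 0 < Real.sqrt q := Real.sqrt_pos.2 hq
  have hcpos : 0 < c := by positivity
  have hc2 : c ^ 2 * q = p := by
    rw [hc, div_pow, Real.sq_sqrt hp.le, Real.sq_sqrt hq.le]; field_simp
  rw [← Ioc_union_Ioi_eq_Ioi hcpos.le, lintegral_union measurableSet_Ioi
    (by rw [Set.disjoint_left]; intro a ha hb; exact absurd ha.2 (not_le.2 hb))]
  have e1 : ∫⁻ s in Ioc 0 c, ENNReal.ofReal (min (p / s ^ 2) q) = ENNReal.ofReal (q * c) := by
    rw [setLIntegral_congr_fun (g := fun _ => ENNReal.ofReal q) measurableSet_Ioc]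
    · rw [setLIntegral_const, Real.volume_Ioc, ← ENNReal.ofReal_mul hq.le, sub_zero]
    · intro s hs
      have : q ≤ p / s ^ 2 := by
        rw [le_div_iff₀ (pow_pos hs.1 2), ← hc2, mul_comm]
        have := pow_le_pow_left₀ hs.1.le hs.2 2
        gcongr
      simp only [min_eq_right this]
  have e2 : ∫⁻ s in Ioi c, ENNReal.ofReal (min (p / s ^ 2) q) = ENNReal.ofReal (p / c) := by
    rw [setLIntegral_congr_fun (g := fun s => ENNReal.ofReal (p * s ^ (-2 : ℝ))) measurableSet_Ioi]
    · rw [← ofReal_integral_eq_lintegral_ofReal]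
      · rw [integral_const_mul, integral_Ioi_rpow_of_lt (by norm_num) hcpos]
        congr 1
        have : c ^ (-2 + 1 : ℝ) = c⁻¹ := by
          rw [show (-2 + 1 : ℝ) = -1 by norm_num, Real.rpow_neg_one]
        rw [this]; norm_num; rw [div_eq_mul_inv]
      · exact (integrableOn_Ioi_rpow_of_lt (by norm_num) hcpos).const_mul p
      · filter_upwards [ae_restrict_mem measurableSet_Ioi] with s hs
        have : 0 < s := hcpos.trans hs
        simp only [Pi.zero_apply]; positivity
    · intro s hs
      have hs0 : 0 < s := hcpos.trans hs
      have : p / s ^ 2 ≤ q := by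
        rw [div_le_iff₀ (pow_pos hs0 2), ← hc2, mul_comm]
        have := pow_le_pow_left₀ hcpos.le (le_of_lt hs) 2
        gcongr
      simp only [min_eq_left this]
      congr 1
      rw [Real.rpow_neg hs0.le, div_eq_mul_inv]
      norm_num
  rw [e1, e2, ← ENNReal.ofReal_add (by positivity) (by positivity)]
  congr 1
  rw [Real.sqrt_mul hp.le, hc]
  have h1 := Real.mul_self_sqrt hp.le
  have h2 := Real.mul_self_sqrt hq.le
  have key : ∀ a b : ℝ, 0 < a → 0 < b → (b * b) * (a / b) + (a * a) / (a / b) = 2 * (a * b) := by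
    intro a b ha hb; field_simp; ring
  have := key _ _ hsp hsq
  rw [h1, h2] at this
  exact this

theorem sqrt_le_lint (a : ℝ) : ENNReal.ofReal (2 * Real.sqrt a) ≤
    ∫⁻ s in Ioi (0 : ℝ), ENNReal.ofReal (min (a / s ^ 2) 1) := by
  rcases le_or_gt 0 a with h | h
  · rw [lint_min h zero_le_one, mul_one]
  · rw [Real.sqrt_eq_zero_of_nonpos h.le]; simp

theorem lint_sqrt_deriv_le {f : ℝ → ℝ} {g : ℝ → ENNReal}
    (h : ∀ s > 0, ∫⁻ x in Ioc (0 : ℝ) 1, ENNReal.ofReal (min (deriv f x / s ^ 2) 1) ≤ g s) :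
    ∫⁻ x in Ioc (0 : ℝ) 1, ENNReal.ofReal (2 * Real.sqrt (deriv f x)) ≤
      ∫⁻ s in Ioi (0 : ℝ), g s := by
  calc _ ≤ ∫⁻ x in Ioc (0 : ℝ) 1, ∫⁻ s in Ioi (0 : ℝ),
        ENNReal.ofReal (min (deriv f x / s ^ 2) 1) := lintegral_mono fun x => sqrt_le_lint _
    _ = ∫⁻ s in Ioi (0 : ℝ), ∫⁻ x in Ioc (0 : ℝ) 1,
        ENNReal.ofReal (min (deriv f x / s ^ 2) 1) := by
        apply lintegral_lintegral_swap
        apply Measurable.aemeasurable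
        have := measurable_deriv f
        simp only [Function.uncurry_def]
        fun_prop
    _ ≤ _ := by
        apply setLIntegral_mono' measurableSet_Ioi
        intro s hs
        exact h s hs

theorem inner_bound {f : ℝ → ℝ} (hf : MonotoneOn f (Icc 0 1)) {x0 s c : ℝ} (hx : x0 ∈ Icc (0 : ℝ) 1)
    (hs : 0 < s) (hc : f 1 - f x0 ≤ c) :
    ∫⁻ x in Ioc (0 : ℝ) 1, ENNReal.ofReal (min (deriv f x / s ^ 2) 1) ≤
      ENNReal.ofReal (c / s ^ 2 + x0) := by
  have hc0 : 0 ≤ c := by linarith [hf hx ⟨zero_le_one, le_rfl⟩ hx.2]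
  rw [← Ioc_union_Ioc_eq_Ioc hx.1 hx.2, add_comm, ENNReal.ofReal_add hx.1 (by positivity)]
  refine (lintegral_union_le _ _ _).trans (add_le_add ?_ ?_)
  · calc _ ≤ ∫⁻ x in Ioc 0 x0, 1 := by
          refine lintegral_mono fun x => ?_
          rw [← ENNReal.ofReal_one]
          exact ENNReal.ofReal_le_ofReal (min_le_right _ _)
      _ = _ := by rw [setLIntegral_const, Real.volume_Ioc]; simp
  · have hf' : MonotoneOn f (uIcc x0 1) := by
      rw [uIcc_of_le hx.2]
      exact hf.mono (Icc_subset_Icc_left hx.1)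
    have hI := hf'.intervalIntegrable_deriv
    have hm := hf'.intervalIntegral_deriv_mem_uIcc
    rw [intervalIntegral.integral_of_le hx.2, uIcc_of_le
      (by linarith [hf hx ⟨zero_le_one, le_rfl⟩ hx.2])] at hm
    have hI' := (intervalIntegrable_iff_integrableOn_Ioc_of_le hx.2).1 hI
    have hpos : 0 ≤ᵐ[volume.restrict (Ioc x0 1)] deriv f := by
      rw [← restrict_Ioo_eq_restrict_Ioc]
      filter_upwards [ae_restrict_mem measurableSet_Ioo] with x hx'
      have hx2 : x ∈ Ioo (0 : ℝ) 1 := ⟨hx.1.trans_lt hx'.1, hx'.2⟩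
      have := hf.derivWithin_nonneg (x := x)
      rwa [derivWithin_of_mem_nhds (Icc_mem_nhds hx2.1 hx2.2)] at this
    calc _ ≤ ∫⁻ x in Ioc x0 1, ENNReal.ofReal (deriv f x / s ^ 2) := by
          refine lintegral_mono fun x => ?_
          exact ENNReal.ofReal_le_ofReal (min_le_left _ _)
      _ = ENNReal.ofReal (∫ x in Ioc x0 1, deriv f x / s ^ 2) := by
          rw [ofReal_integral_eq_lintegral_ofReal]
          · exact hI'.div_const _
          · filter_upwards [hpos] with x hx
            exact div_nonneg hx (by positivity)
      _ ≤ _ := by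
          apply ENNReal.ofReal_le_ofReal
          rw [integral_div]
          have := hm.2.trans hc
          gcongr

theorem B_eq {n : ℕ} {P N : Matrix (Fin n) (Fin n) ℂ} (hP : P.PosSemidef)
    (hP1 : P.trace = 1) (hN : N.PosSemidef) (hN1 : N.trace = 1) :
    ENNReal.ofReal (qBhattacharyya n P N) =
      ∫⁻ x in Ioc (0 : ℝ) 1, ENNReal.ofReal (Real.sqrt (deriv (rocUpper n N P) x)) := by
  unfold qBhattacharyya
  have hf := upper_mono hP hP1 hN hN1
  rw [← uIcc_of_le zero_le_one] at hf
  have hI := (intervalIntegrable_iff_integrableOn_Ioc_of_le zero_le_one).1 hf.intervalIntegrable_deriv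
  rw [intervalIntegral.integral_of_le zero_le_one, ofReal_integral_eq_lintegral_ofReal]
  · refine Integrable.mono' (hI.norm.add (integrable_const (1 : ℝ))) ?_ ?_
    · exact (measurable_deriv _).sqrt.aestronglyMeasurable
    · refine Filter.Eventually.of_forall fun x => ?_
      simp only [Pi.add_apply]
      rw [Real.norm_of_nonneg (Real.sqrt_nonneg _), Real.norm_eq_abs]
      rw [Real.sqrt_le_left (by positivity)]
      nlinarith [le_abs_self (deriv (rocUpper n N P) x), abs_nonneg (deriv (rocUpper n N P) x)]
  · exact Filter.Eventually.of_forall fun x => Real.sqrt_nonneg _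

theorem B_nonneg {n : ℕ} {P N : Matrix (Fin n) (Fin n) ℂ} : 0 ≤ qBhattacharyya n P N :=
  intervalIntegral.integral_nonneg zero_le_one fun _ _ => Real.sqrt_nonneg _

end QB
namespace QB
open MeasureTheory Set

theorem inner2 {n : ℕ} {P N : Matrix (Fin n) (Fin n) ℂ} (hP : P.PosSemidef)
    (hP1 : P.trace = 1) (hN : N.PosSemidef) (hN1 : N.trace = 1) {x y s : ℝ}
    (h : (x, y) ∈ ROCregion n N P) (hs : 0 < s) :
    ∫⁻ x in Ioc (0 : ℝ) 1, ENNReal.ofReal (min (deriv (rocUpper n N P) x / s ^ 2) 1) ≤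
      ENNReal.ofReal ((1 - y) / s ^ 2 + x) := by
  have hb := region_bounds hP hP1 hN hN1 h
  refine inner_bound (upper_mono hP hP1 hN hN1) ⟨hb.1, hb.2.1⟩ hs ?_
  have h1 := le_upper hP hP1 hN hN1 h
  have h2 : rocUpper n N P 1 ≤ 1 := upper_le hP1 hN1 ⟨zero_le_one, le_rfl⟩
    fun y hy => (region_bounds hP hP1 hN hN1 hy).2.2.2
  linarith

theorem diag_mem {n : ℕ} (P N : Matrix (Fin n) (Fin n) ℂ) (S : Fin n → Prop) [DecidablePred S] :
    (∑ i, (if S i then (N i i).re else 0), ∑ i, (if S i then (P i i).re else 0)) ∈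
      ROCregion n N P := by
  obtain ⟨m1, m2⟩ := proj_psd (M := Matrix.diagonal (fun i => if S i then (1 : ℂ) else 0))
    (by rw [Matrix.diagonal_conjTranspose]; congr 1; ext i; by_cases h : S i <;> simp [h])
    (by rw [Matrix.diagonal_mul_diagonal]; congr 1; ext i; by_cases h : S i <;> simp [h])
  refine ⟨_, m1, m2, ?_⟩
  have key : ∀ A : Matrix (Fin n) (Fin n) ℂ,
      ((Matrix.diagonal (fun i => if S i then (1 : ℂ) else 0)) * A).trace.re =
        ∑ i, (if S i then (A i i).re else 0) := by
    intro A
    rw [Matrix.trace, Complex.re_sum]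
    refine Finset.sum_congr rfl fun i _ => ?_
    rw [Matrix.diag_apply, Matrix.diagonal_mul]
    by_cases h : S i <;> simp [h]
  rw [key, key]

theorem sum_re {n : ℕ} {P : Matrix (Fin n) (Fin n) ℂ} (hP1 : P.trace = 1) :
    ∑ i, (P i i).re = 1 := by
  have := congrArg Complex.re hP1
  rw [Matrix.trace, Complex.re_sum] at this
  simpa using this

noncomputable def GG {n : ℕ} (P N : Matrix (Fin n) (Fin n) ℂ) (s : ℝ) : ℝ :=
  ∑ i, min ((P i i).re / s ^ 2) (N i i).re

theorem inner3 {n : ℕ} {P N : Matrix (Fin n) (Fin n) ℂ} (hP : P.PosSemidef)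
    (hP1 : P.trace = 1) (hN : N.PosSemidef) (hN1 : N.trace = 1) {s : ℝ} (hs : 0 < s) :
    ∫⁻ x in Ioc (0 : ℝ) 1, ENNReal.ofReal (min (deriv (rocUpper n N P) x / s ^ 2) 1) ≤
      ENNReal.ofReal (GG P N s) := by
  refine (inner2 hP hP1 hN hN1
    (diag_mem P N (fun i => s ^ 2 * (N i i).re < (P i i).re)) hs).trans_eq ?_
  congr 1
  nth_rw 1 [← sum_re hP1]
  rw [← Finset.sum_sub_distrib, Finset.sum_div, ← Finset.sum_add_distrib]
  refine Finset.sum_congr rfl fun i _ => ?_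
  by_cases h : s ^ 2 * (N i i).re < (P i i).re
  · simp only [h, if_true, sub_self, zero_div, zero_add]
    rw [min_eq_right]
    rw [le_div_iff₀ (by positivity)]; linarith
  · simp only [h, if_false, sub_zero, add_zero]
    rw [min_eq_left]
    rw [div_le_iff₀ (by positivity)]; linarith

theorem lint_GG {n : ℕ} {P N : Matrix (Fin n) (Fin n) ℂ} (hP : P.PosSemidef)
    (hN : N.PosSemidef) : ∫⁻ s in Ioi (0 : ℝ), ENNReal.ofReal (GG P N s) =
      ENNReal.ofReal (2 * ∑ i, Real.sqrt ((P i i).re * (N i i).re)) := by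
  unfold GG
  have h1 : ∀ s : ℝ, ENNReal.ofReal (∑ i, min ((P i i).re / s ^ 2) (N i i).re) =
      ∑ i, ENNReal.ofReal (min ((P i i).re / s ^ 2) (N i i).re) := by
    intro s
    refine ENNReal.ofReal_sum_of_nonneg fun i _ => ?_
    exact le_min (div_nonneg (diag_re_nonneg hP i) (by positivity)) (diag_re_nonneg hN i)
  simp only [h1]
  rw [lintegral_finsetSum _ (fun i _ => by fun_prop), Finset.mul_sum,
    ENNReal.ofReal_sum_of_nonneg (fun i _ => by positivity)]
  exact Finset.sum_congr rfl fun i _ => lint_min (diag_re_nonneg hP i) (diag_re_nonneg hN i)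

theorem two_B {n : ℕ} {P N : Matrix (Fin n) (Fin n) ℂ} (hP : P.PosSemidef)
    (hP1 : P.trace = 1) (hN : N.PosSemidef) (hN1 : N.trace = 1) :
    ENNReal.ofReal (2 * qBhattacharyya n P N) =
      ∫⁻ x in Ioc (0 : ℝ) 1, ENNReal.ofReal (2 * Real.sqrt (deriv (rocUpper n N P) x)) := by
  rw [ENNReal.ofReal_mul zero_le_two, B_eq hP hP1 hN hN1, ← lintegral_const_mul']
  · simp only [ENNReal.ofReal_mul zero_le_two]
  · exact ENNReal.ofReal_ne_top

theorem B_le {n : ℕ} {P N : Matrix (Fin n) (Fin n) ℂ} (hP : P.PosSemidef)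
    (hP1 : P.trace = 1) (hN : N.PosSemidef) (hN1 : N.trace = 1) :
    qBhattacharyya n P N ≤ ∑ i, Real.sqrt ((P i i).re * (N i i).re) := by
  have h := lint_sqrt_deriv_le (f := rocUpper n N P) (g := fun s => ENNReal.ofReal (GG P N s))
    (fun s hs => inner3 hP hP1 hN hN1 hs)
  rw [← two_B hP hP1 hN hN1, lint_GG hP hN, ENNReal.ofReal_le_ofReal_iff (by positivity)] at h
  linarith

theorem HH_of_eq {n : ℕ} {P N : Matrix (Fin n) (Fin n) ℂ} (hP : P.PosSemidef)
    (hP1 : P.trace = 1) (hN : N.PosSemidef) (hN1 : N.trace = 1)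
    (hB : qBhattacharyya n P N = ∑ i, Real.sqrt ((P i i).re * (N i i).re)) : HH P N := by
  intro t ht M m1 m2
  by_contra! hlt
  set x0 := (M * N).trace.re with hx0
  set y0 := (M * P).trace.re with hy0
  have hmem : (x0, y0) ∈ ROCregion n N P := ⟨M, m1, m2, rfl⟩
  set m : ℝ → ℝ := fun s => (1 - y0) / s ^ 2 + x0 with hm
  have hlt0 : m (Real.sqrt t) < GG P N (Real.sqrt t) := by
    have e : ∀ i, max ((P i i).re - t * (N i i).re) 0 =
        (P i i).re - t * min ((P i i).re / t) (N i i).re := by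
      intro i
      rcases le_total ((P i i).re) (t * (N i i).re) with h | h
      · rw [max_eq_right (by linarith), min_eq_left (by rw [div_le_iff₀ ht]; linarith)]
        field_simp; ring
      · rw [max_eq_left (by linarith), min_eq_right (by rw [le_div_iff₀ ht]; linarith)]
    simp only [e, Finset.sum_sub_distrib, sum_re hP1, ← Finset.mul_sum] at hlt
    simp only [hm, GG, Real.sq_sqrt ht.le]
    have : (1 - y0) / t + x0 = (1 - y0 + t * x0) / t := by field_simp
    rw [this, div_lt_iff₀ ht]
    linarith
  have hcm : ContinuousOn m (Ioi 0) := by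
    intro s hs
    have : s ^ 2 ≠ 0 := pow_ne_zero 2 (ne_of_gt hs)
    apply ContinuousAt.continuousWithinAt
    simp only [hm]
    fun_prop (disch := exact this)
  have hcG : ContinuousOn (GG P N) (Ioi 0) := by
    intro s hs
    have : s ^ 2 ≠ 0 := pow_ne_zero 2 (ne_of_gt hs)
    apply ContinuousAt.continuousWithinAt
    unfold GG
    fun_prop (disch := exact this)
  have hGm : Measurable (GG P N) := by unfold GG; fun_prop
  have h := lint_sqrt_deriv_le (f := rocUpper n N P)
    (g := fun s => ENNReal.ofReal (min (m s) (GG P N s)))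
    (fun s hs => by
      rw [ENNReal.ofReal_min]
      exact le_min (inner2 hP hP1 hN hN1 hmem hs) (inner3 hP hP1 hN hN1 hs))
  rw [← two_B hP hP1 hN hN1, hB, ← lint_GG hP hN] at h
  have hae := ae_eq_of_ae_le_of_lintegral_le
    (μ := volume.restrict (Ioi (0 : ℝ)))
    (f := fun s => ENNReal.ofReal (min (m s) (GG P N s)))
    (g := fun s => ENNReal.ofReal (GG P N s))
    (Filter.Eventually.of_forall fun s => ENNReal.ofReal_le_ofReal (min_le_right _ _))
    (by
      refine ne_top_of_le_ne_top ?_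
        (lintegral_mono fun s => ENNReal.ofReal_le_ofReal (min_le_right _ (GG P N s)))
      rw [lint_GG hP hN]; exact ENNReal.ofReal_ne_top)
    hGm.ennreal_ofReal.aemeasurable h
  have hopen : IsOpen (Ioi 0 ∩ (fun s => GG P N s - m s) ⁻¹' (Ioi 0)) :=
    (hcG.sub hcm).isOpen_inter_preimage isOpen_Ioi isOpen_Ioi
  have hpos := hopen.measure_pos volume ⟨Real.sqrt t, Real.sqrt_pos.2 ht, by
    simpa using hlt0⟩
  have hzero : volume (Ioi 0 ∩ (fun s => GG P N s - m s) ⁻¹' (Ioi 0)) = 0 := by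
    rw [Filter.EventuallyEq, ae_restrict_iff' measurableSet_Ioi] at hae
    refine measure_mono_null ?_ hae
    rintro s ⟨hs, hs2⟩ hc
    have hs2' : m s < GG P N s := by simpa using hs2
    have h3 := hc hs
    have hb := region_bounds hP hP1 hN hN1 hmem
    have hm0 : 0 ≤ m s := add_nonneg (div_nonneg (by linarith) (by positivity)) hb.1
    simp only [min_eq_left hs2'.le] at h3
    rw [ENNReal.ofReal_eq_ofReal_iff hm0 (hm0.trans hs2'.le)] at h3
    linarith
  exact absurd hzero hpos.ne'

end QB
namespace QB
open MeasureTheory Set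

noncomputable def xt {n : ℕ} (P N : Matrix (Fin n) (Fin n) ℂ) (s : ℝ) : ℝ :=
  ∑ i, (if s ^ 2 * (N i i).re < (P i i).re then (N i i).re else 0)

theorem xt_meas {n : ℕ} (P N : Matrix (Fin n) (Fin n) ℂ) : Measurable (xt P N) := by
  unfold xt
  refine Finset.measurable_sum _ fun i _ => ?_
  exact Measurable.ite (measurableSet_lt (by fun_prop) measurable_const) measurable_const
    measurable_const

theorem sq_le_deriv {n : ℕ} {P N : Matrix (Fin n) (Fin n) ℂ} (hP : P.PosSemidef)
    (hP1 : P.trace = 1) (hN : N.PosSemidef) (hN1 : N.trace = 1) (H : HH P N) {x s : ℝ}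
    (hx : x ∈ Ioo (0 : ℝ) 1) (hd : DifferentiableAt ℝ (rocUpper n N P) x) (hs : 0 < s)
    (hxs : x < xt P N s) : s ^ 2 ≤ deriv (rocUpper n N P) x := by
  have hmem := diag_mem P N (fun i => s ^ 2 * (N i i).re < (P i i).re)
  set yt := ∑ i, (if s ^ 2 * (N i i).re < (P i i).re then (P i i).re else 0) with hyt
  change (xt P N s, yt) ∈ _ at hmem
  have hb := region_bounds hP hP1 hN hN1 hmem
  have h1 := le_upper hP hP1 hN hN1 hmem
  have hsum : ∑ i, max ((P i i).re - s ^ 2 * (N i i).re) 0 = yt - s ^ 2 * xt P N s := by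
    rw [hyt, xt, Finset.mul_sum, ← Finset.sum_sub_distrib]
    refine Finset.sum_congr rfl fun i _ => ?_
    by_cases h : s ^ 2 * (N i i).re < (P i i).re
    · simp only [h, if_true]; exact max_eq_left (by linarith)
    · simp only [h, if_false]; rw [max_eq_right (by linarith)]; ring
  have h2 : rocUpper n N P x ≤ yt - s ^ 2 * xt P N s + s ^ 2 * x := by
    refine upper_le hP1 hN1 ⟨hx.1.le, hx.2.le⟩ ?_
    rintro y ⟨M, m1, m2, he⟩
    obtain ⟨e1, e2⟩ := Prod.mk.inj he
    have := H (s ^ 2) (by positivity) M m1 m2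
    rw [← e1, ← e2, hsum] at this
    linarith
  have h3 := (upper_concave hP hP1 hN hN1).slope_le_deriv ⟨hx.1.le, hx.2.le⟩ ⟨hb.1, hb.2.1⟩ hxs hd
  refine le_trans ?_ h3
  rw [slope_def_field, le_div_iff₀ (by linarith)]
  linarith

theorem lint_xt {n : ℕ} {P N : Matrix (Fin n) (Fin n) ℂ} (hP : P.PosSemidef)
    (hN : N.PosSemidef) : ENNReal.ofReal (∑ i, Real.sqrt ((P i i).re * (N i i).re)) ≤
      ∫⁻ s in Ioi (0 : ℝ), ENNReal.ofReal (xt P N s) := by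
  have h1 : ∀ s : ℝ, ENNReal.ofReal (xt P N s) =
      ∑ i, ENNReal.ofReal (if s ^ 2 * (N i i).re < (P i i).re then (N i i).re else 0) := by
    intro s
    refine ENNReal.ofReal_sum_of_nonneg fun i _ => ?_
    have := diag_re_nonneg hN i
    split_ifs <;> simp [this]
  simp only [h1]
  rw [lintegral_finsetSum _ (fun i _ => Measurable.ennreal_ofReal (Measurable.ite
    (measurableSet_lt (by fun_prop) measurable_const) measurable_const measurable_const)),
    ENNReal.ofReal_sum_of_nonneg (fun i _ => by positivity)]
  refine Finset.sum_le_sum fun i _ => ?_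
  have hp := diag_re_nonneg hP i
  have hq := diag_re_nonneg hN i
  generalize (P i i).re = p at *
  generalize (N i i).re = q at *
  rcases hq.eq_or_lt with rfl | hq
  · simp
  have hsq : 0 < Real.sqrt q := Real.sqrt_pos.2 hq
  have hsub : Ioo 0 (Real.sqrt p / Real.sqrt q) ⊆ Ioi (0 : ℝ) := fun s hs => hs.1
  calc ENNReal.ofReal (Real.sqrt (p * q))
      = ∫⁻ s in Ioo 0 (Real.sqrt p / Real.sqrt q), ENNReal.ofReal q := by
        rw [setLIntegral_const, Real.volume_Ioo, ← ENNReal.ofReal_mul hq.le, sub_zero,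
          Real.sqrt_mul hp]
        congr 1
        have h2 := Real.mul_self_sqrt hq.le
        have : q * (Real.sqrt p / Real.sqrt q) =
          (Real.sqrt q * Real.sqrt q) * (Real.sqrt p / Real.sqrt q) := by rw [h2]
        rw [this]; field_simp
    _ ≤ ∫⁻ s in Ioo 0 (Real.sqrt p / Real.sqrt q),
          ENNReal.ofReal (if s ^ 2 * q < p then q else 0) := by
        refine setLIntegral_mono' measurableSet_Ioo fun s hs => ?_
        have : s ^ 2 * q < p := by
          have h3 : s * Real.sqrt q < Real.sqrt p := (lt_div_iff₀ hsq).1 hs.2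
          have h4 := pow_lt_pow_left₀ h3 (mul_nonneg hs.1.le hsq.le) two_ne_zero
          rwa [mul_pow, Real.sq_sqrt hq.le, Real.sq_sqrt hp] at h4
        simp [this]
    _ ≤ _ := lintegral_mono_set hsub

theorem le_B {n : ℕ} {P N : Matrix (Fin n) (Fin n) ℂ} (hP : P.PosSemidef)
    (hP1 : P.trace = 1) (hN : N.PosSemidef) (hN1 : N.trace = 1) (H : HH P N) :
    ∑ i, Real.sqrt ((P i i).re * (N i i).re) ≤ qBhattacharyya n P N := by
  rw [← ENNReal.ofReal_le_ofReal_iff B_nonneg, B_eq hP hP1 hN hN1]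
  refine (lint_xt hP hN).trans ?_
  have hmeas : MeasurableSet {z : ℝ × ℝ | z.2 < xt P N z.1} :=
    measurableSet_lt measurable_snd ((xt_meas P N).comp measurable_fst)
  calc ∫⁻ s in Ioi (0 : ℝ), ENNReal.ofReal (xt P N s)
      ≤ ∫⁻ s in Ioi (0 : ℝ), ∫⁻ x in Ioc (0 : ℝ) 1, (if x < xt P N s then 1 else 0) := by
        refine lintegral_mono fun s => ?_
        have hb := region_bounds hP hP1 hN hN1
          (diag_mem P N (fun i => s ^ 2 * (N i i).re < (P i i).re))
        have hle : xt P N s ≤ 1 := hb.2.1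
        calc ENNReal.ofReal (xt P N s) = ∫⁻ x in Ioo 0 (xt P N s), 1 := by
              rw [setLIntegral_const, Real.volume_Ioo]; simp
          _ ≤ ∫⁻ x in Ioo 0 (xt P N s), (if x < xt P N s then 1 else 0) := by
              refine setLIntegral_mono' measurableSet_Ioo fun x hx => ?_
              simp [hx.2]
          _ ≤ _ := lintegral_mono_set (show Ioo 0 (xt P N s) ⊆ Ioc 0 1 from
              fun x hx => ⟨hx.1, hx.2.le.trans hle⟩)
    _ = ∫⁻ x in Ioc (0 : ℝ) 1, ∫⁻ s in Ioi (0 : ℝ), (if x < xt P N s then 1 else 0) := by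
        apply lintegral_lintegral_swap
        apply Measurable.aemeasurable
        simp only [Function.uncurry_def]
        exact Measurable.ite hmeas measurable_const measurable_const
    _ ≤ _ := by
        apply lintegral_mono_ae
        rw [← restrict_Ioo_eq_restrict_Ioc]
        have hdiff := (upper_mono hP hP1 hN hN1).ae_differentiableWithinAt_of_mem
        rw [ae_restrict_iff' measurableSet_Ioo]
        filter_upwards [hdiff] with x hx hx1
        have hd : DifferentiableAt ℝ (rocUpper n N P) x :=
          (hx (Ioo_subset_Icc_self hx1)).differentiableAt (Icc_mem_nhds hx1.1 hx1.2)
        set c := Real.sqrt (deriv (rocUpper n N P) x) with hc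
        calc ∫⁻ s in Ioi (0 : ℝ), (if x < xt P N s then 1 else 0)
            ≤ ∫⁻ s in Ioi (0 : ℝ), (Ioc 0 c).indicator (fun _ => 1) s := by
              refine setLIntegral_mono' measurableSet_Ioi fun s hs => ?_
              by_cases h : x < xt P N s
              · have h2 := sq_le_deriv hP hP1 hN hN1 H hx1 hd hs h
                have h3 : s ≤ c := Real.le_sqrt_of_sq_le h2
                rw [indicator_of_mem (show s ∈ Ioc 0 c from ⟨hs, h3⟩)]
                simp [h]
              · simp [h]
          _ ≤ ∫⁻ s, (Ioc 0 c).indicator (fun _ => 1) s := setLIntegral_le_lintegral _ _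
          _ = ENNReal.ofReal c := by
              rw [lintegral_indicator measurableSet_Ioc, setLIntegral_const, Real.volume_Ioc]; simp

theorem region_sub {n : ℕ} {P N U : Matrix (Fin n) (Fin n) ℂ}
    (h : Uᴴ * U = 1) (h' : U * Uᴴ = 1) :
    ROCregion n N P ⊆ ROCregion n (Uᴴ * N * U) (Uᴴ * P * U) := by
  rintro _ ⟨M, m1, m2, rfl⟩
  refine ⟨Uᴴ * M * U, m1.conjTranspose_mul_mul_same U, ?_, ?_⟩
  · have := m2.conjTranspose_mul_mul_same U
    rwa [mul_sub, sub_mul, mul_one, h] at this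
  · rw [sandwich_mul h', sandwich_mul h', sandwich_trace h', sandwich_trace h']

theorem undo {n : ℕ} {U : Matrix (Fin n) (Fin n) ℂ} (h' : U * Uᴴ = 1)
    (Z : Matrix (Fin n) (Fin n) ℂ) : U * (Uᴴ * Z * U) * Uᴴ = Z := by
  calc _ = (U * Uᴴ) * Z * (U * Uᴴ) := by simp only [Matrix.mul_assoc]
    _ = Z := by rw [h']; simp

theorem B_conj {n : ℕ} {P N U : Matrix (Fin n) (Fin n) ℂ}
    (h : Uᴴ * U = 1) (h' : U * Uᴴ = 1) :
    qBhattacharyya n (Uᴴ * P * U) (Uᴴ * N * U) = qBhattacharyya n P N := by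
  have e : ROCregion n (Uᴴ * N * U) (Uᴴ * P * U) = ROCregion n N P := by
    refine Subset.antisymm ?_ (region_sub h h')
    have := region_sub (P := Uᴴ * P * U) (N := Uᴴ * N * U) (U := Uᴴ) (by simpa using h')
      (by simpa using h)
    rwa [Matrix.conjTranspose_conjTranspose, undo h', undo h'] at this
  unfold qBhattacharyya rocUpper
  rw [e]

end QB

/-- **The quantum Bhattacharyya coefficient is bounded by the square-root
fidelity, with equality iff the states commute.**  Here `sN` is the positive
semidefinite square root of `ρ_N` and `F` is the positive semidefinite square
root of `√ρ_N · ρ_P · √ρ_N`, so that `tr F = tr √(√ρ_N ρ_P √ρ_N)` is the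
square-root fidelity of `ρ_P` and `ρ_N`. -/
theorem qBhattacharyya_le_sqrt_fidelity
    (n : ℕ) (ρP ρN : Matrix (Fin n) (Fin n) ℂ)
    (hP : ρP.PosSemidef) (hP1 : ρP.trace = 1)
    (hN : ρN.PosSemidef) (hN1 : ρN.trace = 1)
    (sN : Matrix (Fin n) (Fin n) ℂ) (hsN : sN.PosSemidef) (hsN2 : sN * sN = ρN)
    (F : Matrix (Fin n) (Fin n) ℂ) (hF : F.PosSemidef) (hF2 : F * F = sN * ρP * sN) :
    qBhattacharyya n ρP ρN ≤ F.trace.re ∧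
      (qBhattacharyya n ρP ρN = F.trace.re ↔ ρP * ρN = ρN * ρP) := by
  obtain ⟨U, h, h', hsum, hcomm⟩ := QB.exists_basis hP hN hsN hsN2 hF hF2
  have hP' := hP.conjTranspose_mul_mul_same U
  have hN' := hN.conjTranspose_mul_mul_same U
  have hP1' := (QB.sandwich_trace (A := ρP) h').trans hP1
  have hN1' := (QB.sandwich_trace (A := ρN) h').trans hN1
  have hle := QB.B_le hP' hP1' hN' hN1'
  have hB := QB.B_conj (P := ρP) (N := ρN) h h'
  rw [hB, hsum] at hle
  refine ⟨hle, fun heq => ?_, fun hc => ?_⟩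
  · have hH := QB.HH_of_eq hP' hP1' hN' hN1' (by rw [hB, hsum, heq])
    have hcm := QB.commute_of_HH hP' hN' hH
    rw [QB.sandwich_mul h', QB.sandwich_mul h'] at hcm
    have := congrArg (fun Z => U * Z * Uᴴ) hcm
    simpa only [QB.undo h'] using this
  · have hge := QB.le_B hP' hP1' hN' hN1' (hcomm hc)
    rw [hB, hsum] at hge
    exact le_antisymm hle hge
end

section
/- Let ρ_P and ρ_N be n×n complex density matrices and let Φ be a quantum channel on n×n complex matrices given in Kraus form, Φ(ρ) = Σᵢ Kᵢ ρ Kᵢ* with Σᵢ Kᵢ* Kᵢ = I. Then the quantum Bhattacharyya coefficient is monotone under the channel: B(Φ(ρ_P), Φ(ρ_N)) ≥ B(ρ_P, ρ_N). -/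
open scoped ComplexOrder Matrix

open MeasureTheory Set Filter Topology

lemma key_layer (u ψ : ℝ → ℝ) (B : ℝ) (hψ : Monotone ψ)
    (hu : IntegrableOn u (Ioo 0 1)) (h0 : ∀ x ∈ Ioo (0:ℝ) 1, 0 ≤ ψ x)
    (hB : ∀ x ∈ Ioo (0:ℝ) 1, ψ x ≤ B)
    (hc : ∀ c ∈ Ioo (0:ℝ) 1, ∫ x in c..1, u x ≤ 0) :
    ∫ x in Ioo (0:ℝ) 1, u x * ψ x ≤ 0 := by
  have hB0 : 0 ≤ B := (h0 (1/2) (by constructor <;> norm_num)).trans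
    (hB (1/2) (by constructor <;> norm_num))
  have huI : IntegrableOn u (Icc 0 1) := by
    rwa [integrableOn_Icc_iff_integrableOn_Ioo]
  have hc' : ∀ c ∈ Ico (0:ℝ) 1, ∫ x in c..1, u x ≤ 0 := by
    intro c hcc
    rcases eq_or_lt_of_le hcc.1 with h | h
    · subst h
      have hcont := intervalIntegral.continuousOn_primitive_interval_left
        (a := (0:ℝ)) (b := 1) (f := u) (μ := volume) (by rwa [uIcc_of_le zero_le_one])
      rw [uIcc_of_le zero_le_one] at hcont
      have h1 := (hcont 0 (by simp)).mono (Ioo_subset_Icc_self)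
      have : (𝓝[Ioo (0:ℝ) 1] 0).NeBot := by
        rw [nhdsWithin_Ioo_eq_nhdsGT zero_lt_one]; infer_instance
      exact le_of_tendsto h1 (eventually_mem_nhdsWithin.mono hc)
    · exact hc c ⟨h, hcc.2⟩
  -- level sets
  have hlev : ∀ t : ℝ, ∫ x in Ioo (0:ℝ) 1, u x * (if t < ψ x then 1 else 0) ≤ 0 := by
    intro t
    have hm : MeasurableSet {x | t < ψ x} := measurableSet_lt measurable_const hψ.measurable
    have e1 : ∀ x, u x * (if t < ψ x then (1:ℝ) else 0) = ({x | t < ψ x}).indicator u x := by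
      intro x; by_cases h : t < ψ x <;> simp [h]
    simp_rw [e1]
    rw [setIntegral_indicator hm]
    set S := Ioo (0:ℝ) 1 ∩ {x | t < ψ x} with hS
    rcases S.eq_empty_or_nonempty with h | ⟨y, hy⟩
    · simp [h]
    have hbdd : BddBelow S := ⟨0, fun x hx => hx.1.1.le⟩
    have hsub1 : Ioo (sInf S) 1 ⊆ S := by
      intro x hx
      obtain ⟨z, hz, hzx⟩ := exists_lt_of_csInf_lt ⟨y, hy⟩ hx.1
      exact ⟨⟨hz.1.1.trans hzx, hx.2⟩, lt_of_lt_of_le hz.2 (hψ hzx.le)⟩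
    have hsub2 : S ⊆ Icc (sInf S) 1 := fun x hx => ⟨csInf_le hbdd hx, hx.1.2.le⟩
    have hae : S =ᵐ[volume] Ioc (sInf S) 1 := by
      apply EventuallyLE.antisymm
      · exact (LE.le.eventuallyLE hsub2).trans Ioc_ae_eq_Icc.symm.le
      · exact Ioo_ae_eq_Ioc.symm.le.trans (LE.le.eventuallyLE hsub1)
    have hlt : sInf S < 1 := (csInf_le hbdd hy).trans_lt hy.1.2
    rw [setIntegral_congr_set hae, ← intervalIntegral.integral_of_le hlt.le]
    exact hc' _ ⟨le_csInf ⟨y, hy⟩ fun x hx => hx.1.1.le, hlt⟩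
  have hrep : ∀ x ∈ Ioo (0:ℝ) 1, u x * ψ x
      = ∫ t in Ioo 0 B, u x * (if t < ψ x then 1 else 0) := by
    intro x hx
    rw [integral_const_mul]
    congr 1
    have e1 : ∀ t, (if t < ψ x then (1:ℝ) else 0) = (Iio (ψ x)).indicator (fun _ => 1) t := by
      intro t; by_cases h : t < ψ x <;> simp [h]
    simp_rw [e1]
    rw [setIntegral_indicator measurableSet_Iio]
    have : Ioo 0 B ∩ Iio (ψ x) = Ioo 0 (ψ x) := by
      ext t; simp only [mem_inter_iff, mem_Ioo, mem_Iio]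
      have := hB x hx
      constructor
      · rintro ⟨⟨a, b⟩, c⟩; exact ⟨a, c⟩
      · rintro ⟨a, c⟩; exact ⟨⟨a, c.trans_le this⟩, c⟩
    rw [this]
    simp [h0 x hx]
  rw [setIntegral_congr_fun measurableSet_Ioo hrep, integral_integral_swap]
  · exact integral_nonpos fun t => hlev t
  · have hm : MeasurableSet {p : ℝ × ℝ | p.2 < ψ p.1} :=
      measurableSet_lt measurable_snd (hψ.measurable.comp measurable_fst)
    have : Integrable (fun p : ℝ × ℝ => u p.1)
        ((volume.restrict (Ioo (0:ℝ) 1)).prod (volume.restrict (Ioo 0 B))) := by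
      have := Integrable.comp_fst (ν := volume.restrict (Ioo 0 B)) hu
      exact this
    refine (this.indicator hm).congr (Eventually.of_forall fun p => ?_)
    by_cases h : p.2 < ψ p.1 <;> simp [h, Function.uncurry]

structure Nice (f : ℝ → ℝ) : Prop where
  conc : ConcaveOn ℝ (Icc 0 1) f
  le1 : ∀ x ∈ Icc (0:ℝ) 1, f x ≤ 1
  ge : ∀ x ∈ Icc (0:ℝ) 1, x ≤ f x

noncomputable def rd (f : ℝ → ℝ) (x : ℝ) : ℝ := derivWithin f (Ioi x) x

lemma Nice.one {f : ℝ → ℝ} (h : Nice f) : f 1 = 1 :=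
  le_antisymm (h.le1 1 (by simp)) (h.ge 1 (by simp))

lemma Nice.mono {f : ℝ → ℝ} (h : Nice f) : MonotoneOn f (Icc 0 1) := by
  intro x hx y hy hxy
  rcases eq_or_lt_of_le hxy with rfl | hxy
  · rfl
  rcases eq_or_lt_of_le hy.2 with rfl | hy1
  · rw [h.one]; exact h.le1 x hx
  by_contra hlt
  push Not at hlt
  have := h.conc.slope_anti_adjacent hx (show (1:ℝ) ∈ Icc (0:ℝ) 1 by simp) hxy hy1
  rw [h.one] at this
  have h1 : (f y - f x) / (y - x) < 0 := div_neg_of_neg_of_pos (by linarith) (by linarith)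
  have h2 : 0 ≤ (1 - f y) / (1 - y) := div_nonneg (by linarith [h.le1 y hy]) (by linarith)
  linarith

lemma Nice.hasRD {f : ℝ → ℝ} (h : Nice f) {x : ℝ} (hx : x ∈ Ioo (0:ℝ) 1) :
    HasDerivWithinAt f (rd f x) (Ioi x) x := by
  have := (h.conc.neg.differentiableWithinAt_Ioi_of_mem_interior
    (x := x) (by rwa [interior_Icc])).neg
  rw [neg_neg] at this
  exact this.hasDerivWithinAt

lemma Nice.rd_nonneg {f : ℝ → ℝ} (h : Nice f) {x : ℝ} (hx : x ∈ Ioo (0:ℝ) 1) :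
    0 ≤ rd f x := by
  have h1 := h.conc.slope_le_rightDeriv (x := x) (y := 1) (Ioo_subset_Icc_self hx) (by simp) hx.2
    (h.hasRD hx).differentiableWithinAt
  refine le_trans ?_ h1
  rw [slope_def_field, h.one]
  exact div_nonneg (by linarith [h.le1 x (Ioo_subset_Icc_self hx)]) (by linarith [hx.2])

lemma Nice.rd_anti {f : ℝ → ℝ} (h : Nice f) : AntitoneOn (rd f) (Ioo 0 1) := by
  have := h.conc.neg.monotoneOn_rightDeriv
  rw [interior_Icc] at this
  intro x hx y hy hxy
  have h2 := this hx hy hxy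
  simp only [derivWithin.neg] at h2
  have h3 : -rd f x ≤ -rd f y := h2
  linarith

lemma Nice.ae_eq {f : ℝ → ℝ} (h : Nice f) :
    deriv f =ᵐ[volume.restrict (Ioo 0 1)] rd f := by
  rw [Filter.EventuallyEq, ae_restrict_iff' measurableSet_Ioo]
  filter_upwards [h.mono.ae_differentiableWithinAt_of_mem] with x hx hx1
  have := (hx (Ioo_subset_Icc_self hx1)).differentiableAt (Icc_mem_nhds hx1.1 hx1.2)
  exact (this.derivWithin (uniqueDiffWithinAt_Ioi x)).symm

lemma Nice.rd_int {f : ℝ → ℝ} (h : Nice f) : IntegrableOn (rd f) (Ioo 0 1) := by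
  have h1 := MonotoneOn.intervalIntegrable_deriv (a := 0) (b := 1) (f := f)
    (by rw [uIcc_of_le zero_le_one]; exact h.mono)
  rw [intervalIntegrable_iff_integrableOn_Ioo_of_le zero_le_one] at h1
  exact h1.congr h.ae_eq

lemma Nice.ftc {f : ℝ → ℝ} (h : Nice f) {c : ℝ} (hc : c ∈ Ioo (0:ℝ) 1) :
    ∫ x in c..1, rd f x = 1 - f c := by
  suffices hs : ∫ x in c..1, rd f x = f 1 - f c by rw [hs, h.one]
  apply intervalIntegral.integral_eq_sub_of_hasDeriv_right
  · rw [uIcc_of_le hc.2.le]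
    intro x hx
    rcases eq_or_lt_of_le hx.2 with rfl | hx1
    · rw [ContinuousWithinAt, h.one]
      refine tendsto_of_tendsto_of_tendsto_of_le_of_le' (g := fun x : ℝ => x) (h := fun _ => 1)
        (tendsto_id.mono_left nhdsWithin_le_nhds) tendsto_const_nhds ?_ ?_
      · filter_upwards [self_mem_nhdsWithin] with y hy
        exact h.ge y ⟨hc.1.le.trans hy.1, hy.2⟩
      · filter_upwards [self_mem_nhdsWithin] with y hy
        exact h.le1 y ⟨hc.1.le.trans hy.1, hy.2⟩
    · have hxm : x ∈ Ioo (0:ℝ) 1 := ⟨hc.1.trans_le hx.1, hx1⟩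
      have := h.conc.continuousOn_interior
      rw [interior_Icc] at this
      exact ((this x hxm).continuousAt (isOpen_Ioo.mem_nhds hxm)).continuousWithinAt
  · intro x hx
    rw [min_eq_left hc.2.le, max_eq_right hc.2.le] at hx
    exact h.hasRD ⟨hc.1.trans hx.1, hx.2⟩
  · rw [intervalIntegrable_iff_integrableOn_Ioo_of_le hc.2.le]
    exact h.rd_int.mono_set (Ioo_subset_Ioo_left hc.1.le)

lemma Nice.sqrt_int {f : ℝ → ℝ} (h : Nice f) {ε : ℝ} (hε : 0 ≤ ε) :
    IntegrableOn (fun x => √(rd f x + ε)) (Ioo 0 1) := by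
  have hi : IntegrableOn (fun x => rd f x + ε + 1) (Ioo 0 1) :=
    (h.rd_int.add (integrableOn_const (by simp))).add (integrableOn_const (by simp))
  refine Integrable.mono' hi ?_ ?_
  · exact Real.continuous_sqrt.comp_aestronglyMeasurable
      (h.rd_int.aestronglyMeasurable.add aestronglyMeasurable_const)
  · rw [ae_restrict_iff' measurableSet_Ioo]
    refine Eventually.of_forall fun x hx => ?_
    have h0 := h.rd_nonneg hx
    rw [Real.norm_of_nonneg (Real.sqrt_nonneg _), Real.sqrt_le_left (by linarith)]
    nlinarith

lemma sqrt_tangent {a b : ℝ} (ha : 0 ≤ a) (hb : 0 < b) :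
    √a ≤ √b + (a - b) * (1 / (2 * √b)) := by
  have hb' := Real.sqrt_pos.2 hb
  have e : √b + (a - b) * (1 / (2 * √b)) = ((√b)^2 + (√a)^2) / (2 * √b) := by
    rw [Real.sq_sqrt ha]
    field_simp
    rw [Real.sq_sqrt hb.le]; ring
  rw [e, le_div_iff₀ (by positivity)]
  nlinarith [sq_nonneg (√a - √b)]

lemma nice_mono {f g : ℝ → ℝ} (hf : Nice f) (hg : Nice g)
    (hfg : ∀ x ∈ Icc (0:ℝ) 1, g x ≤ f x) :
    ∫ x in (0:ℝ)..1, √(deriv f x) ≤ ∫ x in (0:ℝ)..1, √(deriv g x) := by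
  have conv : ∀ f, Nice f → ∫ x in (0:ℝ)..1, √(deriv f x) = ∫ x in Ioo (0:ℝ) 1, √(rd f x) := by
    intro f hf
    rw [intervalIntegral.integral_of_le zero_le_one, integral_Ioc_eq_integral_Ioo]
    apply integral_congr_ae
    filter_upwards [hf.ae_eq] with x hx
    rw [hx]
  rw [conv f hf, conv g hg]
  have hfi := hf.sqrt_int le_rfl
  have hgi := hg.sqrt_int le_rfl
  simp only [add_zero] at hfi hgi
  have main : ∀ ε : ℝ, 0 < ε →
      ∫ x in Ioo (0:ℝ) 1, √(rd f x) ≤ (∫ x in Ioo (0:ℝ) 1, √(rd g x)) + √ε := by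
    intro ε hε
    have hφm : MonotoneOn (fun x => 1 / (2 * √(rd g x + ε))) (Ioo 0 1) := by
      intro x hx y hy hxy
      have h1 := hg.rd_anti hx hy hxy
      have h2 := hg.rd_nonneg hy
      have h3 : 0 < √(rd g y + ε) := Real.sqrt_pos.2 (by linarith)
      have h4 : √(rd g y + ε) ≤ √(rd g x + ε) := Real.sqrt_le_sqrt (by linarith)
      exact one_div_le_one_div_of_le (by positivity) (by linarith)
    have hφ0 : ∀ x, 0 ≤ 1 / (2 * √(rd g x + ε)) := fun x => by positivity
    have hφB : ∀ x ∈ Ioo (0:ℝ) 1, 1 / (2 * √(rd g x + ε)) ≤ 1 / (2 * √ε) := by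
      intro x hx
      have h2 := hg.rd_nonneg hx
      have h3 : 0 < √ε := Real.sqrt_pos.2 hε
      have h4 : √ε ≤ √(rd g x + ε) := Real.sqrt_le_sqrt (by linarith)
      exact one_div_le_one_div_of_le (by positivity) (by linarith)
    obtain ⟨ψ, hψ, hEq⟩ := hφm.exists_monotone_extension
      ⟨0, by rintro _ ⟨x, hx, rfl⟩; exact hφ0 x⟩
      ⟨1 / (2 * √ε), by rintro _ ⟨x, hx, rfl⟩; exact hφB x hx⟩
    have hu : IntegrableOn (fun x => rd f x - rd g x) (Ioo 0 1) := hf.rd_int.sub hg.rd_int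
    have hψ0 : ∀ x ∈ Ioo (0:ℝ) 1, 0 ≤ ψ x := fun x hx => by rw [← hEq hx]; exact hφ0 x
    have hψB : ∀ x ∈ Ioo (0:ℝ) 1, ψ x ≤ 1 / (2 * √ε) :=
      fun x hx => by rw [← hEq hx]; exact hφB x hx
    have hneg := key_layer (fun x => rd f x - rd g x) ψ _ hψ hu hψ0 hψB (by
      intro c hc
      have ii : ∀ f, Nice f → IntervalIntegrable (rd f) volume c 1 := by
        intro f hf
        rw [intervalIntegrable_iff_integrableOn_Ioo_of_le hc.2.le]
        exact hf.rd_int.mono_set (Ioo_subset_Ioo_left hc.1.le)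
      rw [intervalIntegral.integral_sub (ii f hf) (ii g hg), hf.ftc hc, hg.ftc hc]
      linarith [hfg c (Ioo_subset_Icc_self hc)])
    have hui : IntegrableOn (fun x => (rd f x - rd g x) * ψ x) (Ioo 0 1) := by
      refine Integrable.mul_bdd (c := 1 / (2 * √ε)) hu hψ.measurable.aestronglyMeasurable ?_
      rw [ae_restrict_iff' measurableSet_Ioo]
      refine Eventually.of_forall fun x hx => ?_
      rw [Real.norm_of_nonneg (hψ0 x hx)]
      exact hψB x hx
    have hci : IntegrableOn (fun _ : ℝ => √ε) (Ioo (0:ℝ) 1) := integrableOn_const (by simp)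
    have h1 : ∫ x in Ioo (0:ℝ) 1, √(rd f x) ≤
        ∫ x in Ioo (0:ℝ) 1, ((√(rd g x) + √ε) + (rd f x - rd g x) * ψ x) := by
      refine setIntegral_mono_on hfi ((hgi.add hci).add hui) measurableSet_Ioo ?_
      intro x hx
      have a0 := hf.rd_nonneg hx
      have b0 := hg.rd_nonneg hx
      have t := sqrt_tangent (a := rd f x + ε) (b := rd g x + ε) (by linarith) (by linarith)
      have e : ψ x = 1 / (2 * √(rd g x + ε)) := (hEq hx).symm
      rw [e]
      have h5 : √(rd f x) ≤ √(rd f x + ε) := Real.sqrt_le_sqrt (by linarith)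
      have h6 : √(rd g x + ε) ≤ √(rd g x) + √ε := by
        rw [Real.sqrt_le_left (by positivity)]
        nlinarith [Real.sq_sqrt b0, Real.sq_sqrt hε.le,
          mul_nonneg (Real.sqrt_nonneg (rd g x)) (Real.sqrt_nonneg ε)]
      have h7 : rd f x + ε - (rd g x + ε) = rd f x - rd g x := by ring
      rw [h7] at t
      linarith
    have hgc : IntegrableOn (fun x => √(rd g x) + √ε) (Ioo (0:ℝ) 1) := hgi.add hci
    rw [integral_add hgc hui, integral_add hgi hci] at h1
    simp at h1
    linarith
  have hlim : Tendsto (fun ε : ℝ => (∫ x in Ioo (0:ℝ) 1, √(rd g x)) + √ε) (𝓝[>] 0)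
      (𝓝 ((∫ x in Ioo (0:ℝ) 1, √(rd g x)) + √0)) :=
    ((continuous_const.add Real.continuous_sqrt).tendsto 0).mono_left nhdsWithin_le_nhds
  rw [Real.sqrt_zero, add_zero] at hlim
  exact ge_of_tendsto hlim (eventually_mem_nhdsWithin.mono fun ε hε => main ε hε)

lemma trace_re_nonneg {n : ℕ} {M ρ : Matrix (Fin n) (Fin n) ℂ} (hM : M.PosSemidef)
    (hρ : ρ.PosSemidef) : 0 ≤ ((M * ρ).trace).re := by
  obtain ⟨B, rfl⟩ : ∃ B : Matrix (Fin n) (Fin n) ℂ, ρ = Bᴴ * B := by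
    open scoped MatrixOrder in
    exact CStarAlgebra.nonneg_iff_eq_star_mul_self.mp hρ.nonneg
  rw [← Matrix.mul_assoc, Matrix.trace_mul_comm, ← Matrix.mul_assoc]
  exact (Complex.nonneg_iff.mp (hM.mul_mul_conjTranspose_same B).trace_nonneg).1

lemma region_le {n : ℕ} {ρN ρP : Matrix (Fin n) (Fin n) ℂ}
    (hP : ρP.PosSemidef) (hP1 : ρP.trace = 1) {x y : ℝ} (h : (x, y) ∈ ROCregion n ρN ρP) :
    y ≤ 1 := by
  obtain ⟨M, hM, hM1, e⟩ := h
  have h := trace_re_nonneg hM1 hP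
  rw [Matrix.sub_mul, Matrix.one_mul, Matrix.trace_sub, hP1] at h
  simp only [Prod.mk.injEq] at e
  simp at h
  linarith [e.2]

lemma region_diag {n : ℕ} {ρN ρP : Matrix (Fin n) (Fin n) ℂ}
    (hP1 : ρP.trace = 1) (hN1 : ρN.trace = 1) {x : ℝ} (hx : x ∈ Icc (0:ℝ) 1) :
    (x, x) ∈ ROCregion n ρN ρP := by
  refine ⟨x • 1, Matrix.PosSemidef.one.smul hx.1, ?_, ?_⟩
  · have : (1 : Matrix (Fin n) (Fin n) ℂ) - x • 1 = (1 - x) • 1 := by rw [sub_smul, one_smul]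
    rw [this]
    exact Matrix.PosSemidef.one.smul (sub_nonneg.2 hx.2)
  · simp [hP1, hN1]

lemma region_convex (n : ℕ) (ρN ρP : Matrix (Fin n) (Fin n) ℂ) :
    Convex ℝ (ROCregion n ρN ρP) := by
  rintro _ ⟨M, hM, hM1, rfl⟩ _ ⟨M', hM', hM1', rfl⟩ a b ha hb hab
  refine ⟨a • M + b • M', (hM.smul ha).add (hM'.smul hb), ?_, ?_⟩
  · have : 1 - (a • M + b • M') = a • (1 - M) + b • (1 - M') := by
      have e : (1 : Matrix (Fin n) (Fin n) ℂ) = a • 1 + b • 1 := by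
        rw [← add_smul, hab, one_smul]
      rw [smul_sub, smul_sub]
      nth_rewrite 1 [e]
      abel
    rw [this]
    exact (hM1.smul ha).add (hM1'.smul hb)
  · simp [Matrix.add_mul]

lemma roc_nice {n : ℕ} {ρN ρP : Matrix (Fin n) (Fin n) ℂ}
    (hP : ρP.PosSemidef) (hP1 : ρP.trace = 1) (hN1 : ρN.trace = 1) :
    Nice (rocUpper n ρN ρP) := by
  have hbdd : ∀ x, BddAbove {y : ℝ | (x, y) ∈ ROCregion n ρN ρP} :=
    fun x => ⟨1, fun y hy => region_le hP hP1 hy⟩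
  refine ⟨⟨convex_Icc 0 1, ?_⟩, ?_, ?_⟩
  · intro x hx y hy a b ha hb hab
    apply le_of_forall_pos_sub_le
    intro ε hε
    obtain ⟨s, hs, hs'⟩ := exists_lt_of_lt_csSup (b := rocUpper n ρN ρP x - ε)
      (s := {y : ℝ | (x, y) ∈ ROCregion n ρN ρP}) ⟨x, region_diag hP1 hN1 hx⟩
      (by show _ < rocUpper n ρN ρP x; linarith)
    obtain ⟨t, ht, ht'⟩ := exists_lt_of_lt_csSup (b := rocUpper n ρN ρP y - ε)
      (s := {z : ℝ | (y, z) ∈ ROCregion n ρN ρP}) ⟨y, region_diag hP1 hN1 hy⟩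
      (by show _ < rocUpper n ρN ρP y; linarith)
    have hm := region_convex n ρN ρP hs ht ha hb hab
    have h2 : a • s + b • t ≤ rocUpper n ρN ρP (a • x + b • y) := le_csSup (hbdd _) hm
    simp only [smul_eq_mul] at h2 ⊢
    have h3 := mul_le_mul_of_nonneg_left hs'.le ha
    have h4 := mul_le_mul_of_nonneg_left ht'.le hb
    have h5 : a * ε + b * ε = ε := by rw [← add_mul, hab, one_mul]
    linarith
  · intro x hx
    exact csSup_le ⟨x, region_diag hP1 hN1 hx⟩ fun y hy => region_le hP hP1 hy
  · intro x hx
    exact le_csSup (hbdd x) (region_diag hP1 hN1 hx)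

/-- **The quantum Bhattacharyya coefficient is monotone under completely
positive trace-preserving maps.**  If `Φ(ρ) = Σᵢ Kᵢ ρ Kᵢᴴ` is a quantum channel
in Kraus form (`Σᵢ Kᵢᴴ Kᵢ = I`), then
`B(Φ(ρ_P), Φ(ρ_N)) ≥ B(ρ_P, ρ_N)`. -/
theorem qBhattacharyya_mono_under_channel
    (n : ℕ) (ρP ρN : Matrix (Fin n) (Fin n) ℂ)
    (hP : ρP.PosSemidef) (hP1 : ρP.trace = 1)
    (hN : ρN.PosSemidef) (hN1 : ρN.trace = 1)
    (ι : Type) [Fintype ι] (K : ι → Matrix (Fin n) (Fin n) ℂ)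
    (hK : ∑ i, (K i)ᴴ * K i = 1) :
    qBhattacharyya n ρP ρN
      ≤ qBhattacharyya n (∑ i, K i * ρP * (K i)ᴴ) (∑ i, K i * ρN * (K i)ᴴ) := by
  have htr : ∀ M ρ : Matrix (Fin n) (Fin n) ℂ,
      (M * ∑ i, K i * ρ * (K i)ᴴ).trace = ((∑ i, (K i)ᴴ * M * K i) * ρ).trace := by
    intro M ρ
    rw [Finset.mul_sum, Finset.sum_mul, Matrix.trace_sum, Matrix.trace_sum]
    refine Finset.sum_congr rfl fun i _ => ?_
    rw [← Matrix.mul_assoc, Matrix.trace_mul_comm]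
    simp only [Matrix.mul_assoc]
  have htr1 : ∀ ρ : Matrix (Fin n) (Fin n) ℂ, (∑ i, K i * ρ * (K i)ᴴ).trace = ρ.trace := by
    intro ρ
    have := htr 1 ρ
    simpa [hK] using this
  have hps : ∀ M : Matrix (Fin n) (Fin n) ℂ, M.PosSemidef →
      (∑ i, (K i)ᴴ * M * K i).PosSemidef := fun M hM =>
    Matrix.posSemidef_sum _ fun i _ => hM.conjTranspose_mul_mul_same (K i)
  have hPΦ : (∑ i, K i * ρP * (K i)ᴴ).PosSemidef :=
    Matrix.posSemidef_sum _ fun i _ => hP.mul_mul_conjTranspose_same (K i)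
  have hf := roc_nice hP hP1 hN1
  have hg := roc_nice (ρN := ∑ i, K i * ρN * (K i)ᴴ) hPΦ ((htr1 ρP).trans hP1)
    ((htr1 ρN).trans hN1)
  refine nice_mono hf hg fun x hx => ?_
  refine csSup_le_csSup ⟨1, fun y hy => region_le hP hP1 hy⟩
    ⟨x, region_diag ((htr1 ρP).trans hP1) ((htr1 ρN).trans hN1) hx⟩ ?_
  rintro y ⟨M, hM, hM1, e⟩
  refine ⟨∑ i, (K i)ᴴ * M * K i, hps M hM, ?_, ?_⟩
  · have := hps _ hM1
    simpa [Matrix.mul_sub, Matrix.sub_mul, Finset.sum_sub_distrib, hK] using this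
  · rw [e, htr, htr]
end
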